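/- arXiv:2407.09272 — 2 statements merged into one kernel-verified Lean document; each statement's English description precedes it below -/
import Mathlib

section
/- Let F be a free group, w ∈ F, and let G = F/⟪w⟫ be a torsion-free one-relator group. If G is not residually ℚ-solvable, then the subgroup D^ω(G) is not finitely generated. -/
def ratDerived (G : Type*) [Group G] : ℕ → Subgroup G
  | 0 => ⊤
  | i + 1 =>
      Subgroup.closure
        {g | g ∈ ratDerived G i ∧
          ∃ k : ℕ, 1 ≤ k ∧ g ^ k ∈ ⁅ratDerived G i, ratDerived G i⁆}

instance ratDerived_normal (G : Type*) [Group G] (i : ℕ) : (ratDerived G i).Normal := by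
  induction i with
  | zero =>
    show (⊤ : Subgroup G).Normal
    infer_instance
  | succ i ih =>
    haveI := ih
    constructor
    intro x hx g
    have himg : (fun y => g * y * g⁻¹) ''
        {y | y ∈ ratDerived G i ∧ ∃ k : ℕ, 1 ≤ k ∧ y ^ k ∈ ⁅ratDerived G i, ratDerived G i⁆} ⊆
        {y | y ∈ ratDerived G i ∧ ∃ k : ℕ, 1 ≤ k ∧ y ^ k ∈ ⁅ratDerived G i, ratDerived G i⁆} := by
      rintro _ ⟨y, ⟨hy, k, hk, hyk⟩, rfl⟩
      refine ⟨ih.conj_mem y hy g, k, hk, ?_⟩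
      rw [conj_pow]
      exact (Subgroup.commutator_normal _ _).conj_mem _ hyk g
    have hmap : (ratDerived G (i + 1)).map (MulAut.conj g).toMonoidHom ≤ ratDerived G (i + 1) := by
      show (Subgroup.closure _).map _ ≤ Subgroup.closure _
      rw [MonoidHom.map_closure]
      refine (Subgroup.closure_le _).2 (fun y hy => Subgroup.subset_closure (himg ?_))
      simpa using hy
    exact hmap ⟨x, hx, rfl⟩

def ratDerivedOmega (G : Type*) [Group G] : Subgroup G := ⨅ i, ratDerived G i

instance ratDerivedOmega_normal (G : Type*) [Group G] : (ratDerivedOmega G).Normal := by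
  constructor
  intro x hx g
  simp only [ratDerivedOmega, Subgroup.mem_iInf] at hx ⊢
  exact fun i => (ratDerived_normal G i).conj_mem x (hx i) g

def QSolvable (G : Type*) [Group G] : Prop := ∃ n : ℕ, ratDerived G n = ⊥

def ResiduallyQSolvable (G : Type*) [Group G] : Prop := ratDerivedOmega G = ⊥

namespace FreeGroup

universe u

section Support

variable {E : Type*} [DecidableEq E]

/-- The letters that occur in the reduced word of `x`. -/
def supp (x : FreeGroup E) : Finset E := (x.toWord.map Prod.fst).toFinset

theorem mem_supp {x : FreeGroup E} {e : E} : e ∈ supp x ↔ ∃ b, (e, b) ∈ x.toWord := by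
  simp [supp]

theorem lift_congr_supp {H : Type*} [Group H] {a b : E → H} {x : FreeGroup E}
    (h : ∀ e ∈ supp x, a e = b e) : lift a x = lift b x := by
  rw [← mk_toWord (x := x), lift_mk, lift_mk]
  congr 1
  refine List.map_congr_left fun p hp => ?_
  rw [h p.1 (mem_supp.2 ⟨p.2, hp⟩)]

theorem card_supp_le (x : FreeGroup E) : (supp x).card ≤ x.norm := by
  refine (List.toFinset_card_le _).trans ?_
  simp [norm]

theorem supp_nonempty {x : FreeGroup E} (hx : x ≠ 1) : (supp x).Nonempty := by
  have h : x.toWord ≠ [] := fun h => hx (toWord_eq_nil_iff.1 h)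
  obtain ⟨p, hp⟩ := List.exists_mem_of_ne_nil _ h
  exact ⟨p.1, mem_supp.2 ⟨p.2, hp⟩⟩

/-- The number of occurrences of `e` or its inverse in the reduced word of `x`. -/
def letterCount (e : E) (x : FreeGroup E) : ℕ := (x.toWord.map Prod.fst).count e

theorem letterCount_pos {e : E} {x : FreeGroup E} : 0 < letterCount e x ↔ e ∈ supp x := by
  simp [letterCount, supp, List.count_pos_iff]

theorem letterCount_mul_le (e : E) (x y : FreeGroup E) :
    letterCount e (x * y) ≤ letterCount e x + letterCount e y := by
  have h := ((toWord_mul_sublist x y).map Prod.fst).count_le e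
  simpa [letterCount] using h

theorem letterCount_pow_of_notMem {e : E} {x : FreeGroup E} (h : e ∉ supp x) (n : ℕ) :
    letterCount e (x ^ n) = 0 := by
  have hx : letterCount e x = 0 := by
    have := mt letterCount_pos.1 h
    omega
  induction n with
  | zero => simp [letterCount]
  | succ n ih =>
    have := letterCount_mul_le e (x ^ n) x
    rw [pow_succ]
    omega

theorem letterCount_pow_of_isCyclicallyReduced {x : FreeGroup E}
    (hx : IsCyclicallyReduced x.toWord) (e : E) (n : ℕ) :
    letterCount e (x ^ n) = n * letterCount e x := by
  have h : (x ^ n).toWord = (List.replicate n x.toWord).flatten := by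
    rw [toWord_pow]
    exact (hx.flatten_replicate n).isReduced.reduce_eq
  rw [letterCount, h, letterCount]
  clear h
  induction n with
  | zero => simp
  | succ n ih => simp_all [List.replicate_succ, add_mul, add_comm]

theorem IsCyclicallyReduced.notMem_supp_of_conj {x y g : FreeGroup E}
    (hx : IsCyclicallyReduced x.toWord) (h : x = g * y * g⁻¹) {e : E} (he : e ∉ supp y) :
    e ∉ supp x := by
  intro hex
  have h0 := letterCount_pos.2 hex
  set N := letterCount e g + letterCount e g⁻¹ + 1 with hN
  have h1 := letterCount_pow_of_isCyclicallyReduced hx e N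
  have h2 : x ^ N = g * y ^ N * g⁻¹ := by rw [h, conj_pow]
  have h3 := letterCount_mul_le e (g * y ^ N) g⁻¹
  have h4 := letterCount_mul_le e g (y ^ N)
  have h5 := letterCount_pow_of_notMem he N
  rw [← h2] at h3
  nlinarith

theorem notMem_supp_lift {E' : Type*} {a : E' → FreeGroup E} {e : E}
    (ha : ∀ i, e ∉ supp (a i)) (x : FreeGroup E') : e ∉ supp (lift a x) := by
  have key : ∀ y : FreeGroup E, e ∉ supp y ↔ letterCount e y = 0 := fun y => by
    rw [← letterCount_pos]; omega
  rw [key]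
  induction x using FreeGroup.induction_on with
  | C1 => simp [letterCount]
  | of i => simpa [key] using ha i
  | inv_of i _ =>
    have := ha i
    rw [key] at this
    simpa [letterCount, invRev, Function.comp_def, List.count_eq_zero] using this
  | mul x y hx hy =>
    have := letterCount_mul_le e (lift a x) (lift a y)
    rw [_root_.map_mul]
    omega

end Support

/-- The value at `x` of the homomorphism to `ℚ` that extends `φ`. -/
def ratSum {E : Type*} (φ : E → ℚ) (x : FreeGroup E) : ℚ :=
  (lift (fun e => Multiplicative.ofAdd (φ e)) x).toAdd

section RatSum

variable {E : Type*} (φ : E → ℚ)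

@[simp] theorem ratSum_one : ratSum φ 1 = 0 := by simp [ratSum]

@[simp] theorem ratSum_of (e : E) : ratSum φ (of e) = φ e := by simp [ratSum]

@[simp] theorem ratSum_mul (x y : FreeGroup E) :
    ratSum φ (x * y) = ratSum φ x + ratSum φ y := by simp [ratSum]

@[simp] theorem ratSum_inv (x : FreeGroup E) : ratSum φ x⁻¹ = - ratSum φ x := by simp [ratSum]

@[simp] theorem ratSum_zpow (x : FreeGroup E) (n : ℤ) :
    ratSum φ (x ^ n) = n * ratSum φ x := by simp [ratSum]

theorem ratSum_lift {ι : Type*} (u : ι → FreeGroup E) (c : FreeGroup ι) :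
    ratSum φ (lift u c) = ratSum (fun i => ratSum φ (u i)) c := by
  induction c using FreeGroup.induction_on with
  | C1 => simp
  | of i => simp
  | inv_of i _ => simp
  | mul x y hx hy => simp [hx, hy]

theorem ratSum_congr [DecidableEq E] {φ ψ : E → ℚ} {x : FreeGroup E}
    (h : ∀ e ∈ supp x, φ e = ψ e) : ratSum φ x = ratSum ψ x := by
  unfold ratSum
  rw [lift_congr_supp]
  intro e he
  rw [h e he]

theorem ratSum_add (φ ψ : E → ℚ) (x : FreeGroup E) :
    ratSum (fun e => φ e + ψ e) x = ratSum φ x + ratSum ψ x := by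
  induction x using FreeGroup.induction_on with
  | C1 => simp
  | of i => simp
  | inv_of i _ => simp; ring
  | mul x y hx hy => simp [hx, hy]; ring

theorem ratSum_const_mul (c : ℚ) (φ : E → ℚ) (x : FreeGroup E) :
    ratSum (fun e => c * φ e) x = c * ratSum φ x := by
  induction x using FreeGroup.induction_on with
  | C1 => simp
  | of i => simp
  | inv_of i _ => simp
  | mul x y hx hy => simp [hx, hy]; ring

/-- If only the letter `e` is sent to a nontrivial element, the value of a word is a power. -/
theorem lift_eq_zpow_of_single [DecidableEq E] {H : Type*} [Group H] (e : E) (x : FreeGroup E) :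
    ∃ n : ℤ, (n : ℚ) = ratSum (fun e' => if e' = e then 1 else 0) x ∧
      ∀ b : E → H, (∀ e' ∈ supp x, e' ≠ e → b e' = 1) → lift b x = b e ^ n := by
  suffices h : ∃ n : ℤ, (n : ℚ) = ratSum (fun e' => if e' = e then 1 else 0) x ∧
      ∀ b : E → H, (∀ e', e' ≠ e → b e' = 1) → lift b x = b e ^ n by
    obtain ⟨n, hn, h⟩ := h
    refine ⟨n, hn, fun b hb => ?_⟩
    have := h (fun e' => if e' = e then b e else 1) (fun e' he' => by simp [he'])
    simp only [if_true] at this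
    rw [← this]
    refine lift_congr_supp fun e' he' => ?_
    by_cases h' : e' = e
    · simp [h']
    · simp [h', hb e' he' h']
  induction x using FreeGroup.induction_on with
  | C1 => exact ⟨0, by simp, by simp⟩
  | of i =>
    by_cases hi : i = e
    · exact ⟨1, by simp [hi], by simp [hi]⟩
    · exact ⟨0, by simp [hi], fun b hb => by simp [hb i hi]⟩
  | inv_of i h =>
    obtain ⟨n, hn, h⟩ := h
    exact ⟨-n, by simp [hn], fun b hb => by rw [_root_.map_inv, h b hb, zpow_neg]⟩
  | mul x y hx hy =>
    obtain ⟨n, hn, hx⟩ := hx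
    obtain ⟨m, hm, hy⟩ := hy
    exact ⟨n + m, by simp [hn, hm], fun b hb => by
      rw [_root_.map_mul, hx b hb, hy b hb, zpow_add]⟩

end RatSum

open scoped Classical in
/-- `IsWalk src tgt v L v'`: the word `L` is the label of an edge path from `v` to `v'` in the
graph with edges `E`, sources `src` and targets `tgt`. -/
def IsWalk {V E : Type*} (src tgt : E → V) : V → List (E × Bool) → V → Prop
  | v, [], v' => v = v'
  | v, p :: L, v' =>
      cond p.2 (src p.1) (tgt p.1) = v ∧ IsWalk src tgt (cond p.2 (tgt p.1) (src p.1)) L v'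

section Walk

variable {V E : Type*} {src tgt : E → V}

theorem IsWalk.lift_mk_eq {H : Type*} [Group H] {a b : E → H} {g : V → H} {L : List (E × Bool)}
    {v v' : V} (hL : IsWalk src tgt v L v')
    (h : ∀ p ∈ L, a p.1 = (g (src p.1))⁻¹ * b p.1 * g (tgt p.1)) :
    lift a (mk L) = (g v)⁻¹ * lift b (mk L) * g v' := by
  induction L generalizing v with
  | nil =>
    obtain rfl : v = v' := hL
    simp [lift_mk]
  | cons p L ih =>
    obtain ⟨h1, h2⟩ := hL
    have h3 := ih h2 fun q hq => h q (List.mem_cons_of_mem _ hq)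
    have h4 := h p List.mem_cons_self
    simp only [lift_mk] at h3
    simp only [lift_mk, List.map_cons, List.prod_cons]
    rw [h3]
    obtain ⟨e, c⟩ := p
    cases c <;> subst h1 <;> simp only [cond_true, cond_false] at h4 ⊢ <;> rw [h4] <;> group

theorem IsWalk.lift_eq [DecidableEq E] {H : Type*} [Group H] {a b : E → H} {g : V → H}
    {x : FreeGroup E} {v v' : V} (hx : IsWalk src tgt v x.toWord v')
    (h : ∀ e ∈ supp x, a e = (g (src e))⁻¹ * b e * g (tgt e)) :
    lift a x = (g v)⁻¹ * lift b x * g v' := by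
  have := hx.lift_mk_eq (a := a) (b := b) (g := g) fun p hp => h p.1 (mem_supp.2 ⟨p.2, hp⟩)
  rwa [mk_toWord] at this

theorem IsWalk.ratSum_eq [DecidableEq E] {φ ψ : E → ℚ} {h : V → ℚ}
    {x : FreeGroup E} {v v' : V} (hx : IsWalk src tgt v x.toWord v')
    (hφ : ∀ e ∈ supp x, φ e = ψ e + (h (tgt e) - h (src e))) :
    ratSum φ x = ratSum ψ x + (h v' - h v) := by
  have := hx.lift_eq (a := fun e => Multiplicative.ofAdd (φ e))
    (b := fun e => Multiplicative.ofAdd (ψ e)) (g := fun v => Multiplicative.ofAdd (h v))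
    fun e he => by
      apply Multiplicative.toAdd.injective
      simp [hφ e he]
      ring
  have := congrArg Multiplicative.toAdd this
  simp only [toAdd_mul, toAdd_inv, toAdd_ofAdd] at this
  simp only [ratSum]
  rw [this]
  ring

/-- A walk all of whose edges respect the predicate `s` stays on one side of `s`. -/
theorem IsWalk.side {s : V → Prop} {L : List (E × Bool)} {v v' : V}
    (hL : IsWalk src tgt v L v') (h : ∀ p ∈ L, (s (src p.1) ↔ s (tgt p.1))) :
    ∀ p ∈ L, (s (src p.1) ↔ s v) := by
  induction L generalizing v with
  | nil => simp
  | cons p L ih =>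
    obtain ⟨h1, h2⟩ := hL
    have h3 := ih h2 fun q hq => h q (List.mem_cons_of_mem _ hq)
    have h4 := h p List.mem_cons_self
    have h5 : s (src p.1) ↔ s v := by
      obtain ⟨e, c⟩ := p
      cases c <;> subst h1 <;> simp_all
    intro q hq
    rcases List.mem_cons.1 hq with rfl | hq
    · exact h5
    · rw [h3 q hq, ← h5]
      obtain ⟨e, c⟩ := p
      cases c <;> simp_all

end Walk

section Forest

variable {V E : Type*}

/-- Every rational function on the edges in `T` is a coboundary, that is, `T` is a forest. -/
def Forest (src tgt : E → V) (T : Finset E) : Prop :=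
  ∀ φ : E → ℚ, ∃ h : V → ℚ, ∀ e ∈ T, φ e = h (tgt e) - h (src e)

variable {src tgt : E → V}

theorem Forest.mono {T T' : Finset E} (hT : Forest src tgt T) (h : T' ⊆ T) :
    Forest src tgt T' := fun φ => by
  obtain ⟨k, hk⟩ := hT φ
  exact ⟨k, fun e he => hk e (h he)⟩

theorem Forest.exists_potential {H : Type*} [Group H] (a : E → H) {T : Finset E}
    (hT : Forest src tgt T) : ∃ g : V → H, ∀ e ∈ T, a e = (g (src e))⁻¹ * g (tgt e) := by
  classical
  induction T using Finset.induction_on with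
  | empty => exact ⟨fun _ => 1, by simp⟩
  | insert e T he ih =>
    obtain ⟨g, hg⟩ := ih (hT.mono (Finset.subset_insert _ _))
    obtain ⟨h, hh⟩ := hT fun e' => if e' = e then 1 else 0
    have he1 := hh e (Finset.mem_insert_self _ _)
    simp only [if_true] at he1
    refine ⟨fun v => if h v = h (tgt e) then g (src e) * a e * (g (tgt e))⁻¹ * g v else g v,
      fun e' he' => ?_⟩
    rcases Finset.mem_insert.1 he' with rfl | he'T
    · have : h (src e') ≠ h (tgt e') := fun h' => by rw [h'] at he1; simp at he1
      simp [this]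
    · have hne : e' ≠ e := fun h' => he (h' ▸ he'T)
      have h1 := hh e' he'
      rw [if_neg hne] at h1
      have h2 : h (src e') = h (tgt e') := by linarith
      rw [hg e' he'T]
      simp only [h2]
      split_ifs <;> group

/-- A cyclically reduced closed walk cannot cross a bridge one of whose sides is a tree. -/
theorem IsWalk.not_bridge [DecidableEq E] {w : FreeGroup E} (hw : IsCyclicallyReduced w.toWord)
    {v : V} (hv : IsWalk src tgt v w.toWord v) {e : E} (he : e ∈ supp w) {s : V → Prop}
    (hs : ∀ e' ∈ supp w, e' ≠ e → (s (src e') ↔ s (tgt e')))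
    (hse : s (src e) ↔ ¬ s (tgt e)) {g : V → FreeGroup E}
    (hg : ∀ e' ∈ supp w, e' ≠ e → s (src e') → of e' = (g (src e'))⁻¹ * g (tgt e')) : False := by
  classical
  set z : FreeGroup E := if s (tgt e) then of e * (g (tgt e))⁻¹ else (of e)⁻¹ * (g (src e))⁻¹
    with hz
  have key := hv.lift_eq (a := of) (b := fun e' => if e' = e ∨ s (src e') then 1 else of e')
    (g := fun v => if s v then z * g v else 1) fun e' he' => by
      by_cases h1 : e' = e
      · subst h1
        by_cases h2 : s (tgt e')
        · have h3 : ¬ s (src e') := fun h => hse.1 h h2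
          simp [h2, h3, hz]
        · have h3 : s (src e') := hse.2 h2
          simp [h2, h3, hz]
      · have h2 := hs e' he' h1
        by_cases h3 : s (src e')
        · have h4 := h2.1 h3
          simp only [h1, h3, h4, or_true, if_true]
          rw [hg e' he' h1 h3]
          group
        · have h4 : ¬ s (tgt e') := fun h => h3 (h2.2 h)
          simp [h1, h3, h4]
  rw [lift_of_eq_id] at key
  simp only [MonoidHom.id_apply] at key
  refine hw.notMem_supp_of_conj (g := (if s v then z * g v else 1)⁻¹) (y := _)
    (by rw [inv_inv]; exact key) (e := e) (notMem_supp_lift (fun e' => ?_) w) he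
  split_ifs with h
  · simp [supp]
  · push Not at h
    simpa [supp] using h.1.symm

end Forest

/-- Both the largest and the smallest letter of `w` are smaller than those of `w'`. -/
def StagLT {E : Type*} [LinearOrder E] (w w' : FreeGroup E) : Prop :=
  (∃ e ∈ supp w', ∀ e' ∈ supp w, e' < e) ∧ ∃ e ∈ supp w, ∀ e' ∈ supp w', e < e'

/-- A staggered family of closed walks, each cyclically reduced and not a proper power. -/
structure Staggered {V E : Type*} [LinearOrder E] (src tgt : E → V)
    (R : Set (FreeGroup E)) : Prop where
  isCyclicallyReduced : ∀ w ∈ R, IsCyclicallyReduced w.toWord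
  not_proper_power : ∀ w ∈ R, ∀ (c : FreeGroup E) (m : ℕ), w = c ^ m → m = 1
  loop : ∀ w ∈ R, ∃ v, IsWalk src tgt v w.toWord v
  stag : ∀ w ∈ R, ∀ w' ∈ R, w ≠ w' → StagLT w w' ∨ StagLT w' w

section

variable {V E : Type u} [LinearOrder E] {src tgt : E → V}

theorem Staggered.mono {R R' : Set (FreeGroup E)} (hR : Staggered src tgt R) (h : R' ⊆ R) :
    Staggered src tgt R' where
  isCyclicallyReduced w hw := hR.isCyclicallyReduced w (h hw)
  not_proper_power w hw := hR.not_proper_power w (h hw)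
  loop w hw := hR.loop w (h hw)
  stag w hw w' hw' := hR.stag w (h hw) w' (h hw')

theorem Staggered.ne_one {R : Set (FreeGroup E)} (hR : Staggered src tgt R) {w : FreeGroup E}
    (hw : w ∈ R) : w ≠ 1 := fun h => by
  have := hR.not_proper_power w hw 1 0 (by simp [h])
  omega

/-- Every rational cocycle on the complex with edges `A` and relators `R` is a coboundary. -/
def QAcyclic {V E : Type*} [DecidableEq E] (src tgt : E → V) (A : Finset E)
    (R : Set (FreeGroup E)) : Prop :=
  ∀ φ : E → ℚ, (∀ w ∈ R, ratSum φ w = 0) →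
    ∃ h : V → ℚ, ∀ e ∈ A, φ e = h (tgt e) - h (src e)

open scoped Classical in
/-- The edges of `A` that are not the smallest letter of an element of `R`. -/
noncomputable def collapsed (A : Finset E) (R : Set (FreeGroup E)) : Finset E :=
  A.filter fun e => ∀ w ∈ R, ¬ IsLeast (supp w : Set E) e

theorem mem_collapsed {A : Finset E} {R : Set (FreeGroup E)} {e : E} :
    e ∈ collapsed A R ↔ e ∈ A ∧ ∀ w ∈ R, ¬ IsLeast (supp w : Set E) e := by
  classical
  simp [collapsed]

theorem collapsed_subset (A : Finset E) (R : Set (FreeGroup E)) : collapsed A R ⊆ A :=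
  fun _ he => (mem_collapsed.1 he).1

theorem exists_eq_zpow_of_potential {w : FreeGroup E} {v : V}
    (hv : IsWalk src tgt v w.toWord v) (e : E) :
    ∃ n : ℤ, (n : ℚ) = ratSum (fun e' => if e' = e then 1 else 0) w ∧
      ∀ (H : Type u) [Group H] (a : E → H) (g : V → H),
        (∀ e' ∈ supp w, e' ≠ e → a e' = (g (src e'))⁻¹ * g (tgt e')) →
        lift a w = ((g v)⁻¹ * (g (src e) * a e * (g (tgt e))⁻¹) * g v) ^ n := by
  obtain ⟨n, hn, -⟩ := lift_eq_zpow_of_single (H := FreeGroup E) e w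
  refine ⟨n, hn, fun H _ a g ha => ?_⟩
  obtain ⟨n', hn', h⟩ := lift_eq_zpow_of_single (H := H) e w
  obtain rfl : n = n' := by
    rw [← hn'] at hn
    exact_mod_cast hn
  rw [hv.lift_eq (a := a) (g := g)
    (b := fun e' => if e' = e then g (src e) * a e * (g (tgt e))⁻¹ else 1), h]
  · have := conj_zpow (i := n) (a := (g v)⁻¹) (b := g (src e) * a e * (g (tgt e))⁻¹)
    rw [inv_inv] at this
    simp [this]
  · intro e' _ h'
    simp [h']
  · intro e' he'
    by_cases h' : e' = e
    · subst h'
      simp only [if_true]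
      group
    · simp [h', ha e' he' h']

theorem Staggered.exists_greatest {R : Finset (FreeGroup E)} (hR : Staggered src tgt (R : Set _))
    (hne : R.Nonempty) : ∃ w ∈ R, ∃ e ∈ supp w, ∀ w' ∈ R, w' ≠ w → e ∉ supp w' ∧
      ∀ f, IsLeast (supp w' : Set E) f → f ∉ supp w := by
  obtain ⟨w, hw, hmax⟩ := R.exists_max_image (fun w => (supp w).max) hne
  obtain ⟨e, he⟩ := Finset.max_of_nonempty (supp_nonempty (hR.ne_one hw))
  refine ⟨w, hw, e, Finset.mem_of_max he, fun w' hw' hne' => ?_⟩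
  have h1 : StagLT w' w := by
    refine (hR.stag w' hw' w hw hne').resolve_right fun h => ?_
    obtain ⟨e', he', h2⟩ := h.1
    have h3 := h2 e (Finset.mem_of_max he)
    have h4 := (Finset.le_max he').trans (hmax w' hw')
    rw [he] at h4
    exact absurd (WithBot.coe_le_coe.1 h4) (not_le.2 h3)
  obtain ⟨⟨e1, he1, h2⟩, e0, he0, h3⟩ := h1
  refine ⟨fun h => ?_, fun f hf hfw => ?_⟩
  · exact absurd (Finset.le_max_of_eq he1 he) (not_le.2 (h2 e h))
  · exact absurd (hf.2 he0) (not_le.2 (h3 f hfw))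

/-- If a relator crosses a bridge, then one side of the bridge is acyclic. -/
theorem QAcyclic.side {A : Finset E} {R R' : Set (FreeGroup E)} (hA : QAcyclic src tgt A R)
    {w : FreeGroup E} (hR' : ∀ w' ∈ R, w' ≠ w → w' ∈ R')
    {A₁ A₂ : Finset E} {R₁ R₂ : Set (FreeGroup E)} (hA₁ : A₁ ⊆ A) (hA₂ : A₂ ⊆ A)
    (hd : Disjoint A₁ A₂) (hR : ∀ w' ∈ R', (w' ∈ R₁ ∧ supp w' ⊆ A₁) ∨ (w' ∈ R₂ ∧ supp w' ⊆ A₂)) :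
    QAcyclic src tgt A₁ R₁ ∨ QAcyclic src tgt A₂ R₂ := by
  classical
  by_contra! hcon
  obtain ⟨h1, h2⟩ := hcon
  simp only [QAcyclic, not_forall] at h1 h2
  obtain ⟨φ₁, hφ₁, h1⟩ := h1
  obtain ⟨φ₂, hφ₂, h2⟩ := h2
  set ψ₁ : E → ℚ := fun e => if e ∈ A₁ then φ₁ e else 0 with hψ₁
  set ψ₂ : E → ℚ := fun e => if e ∈ A₂ then φ₂ e else 0 with hψ₂
  obtain ⟨a, b, hab, h0⟩ : ∃ a b : ℚ, (a ≠ 0 ∨ b ≠ 0) ∧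
      a * ratSum ψ₁ w + b * ratSum ψ₂ w = 0 := by
    by_cases h : ratSum ψ₁ w = 0
    · exact ⟨1, 0, by simp, by simp [h]⟩
    · exact ⟨- ratSum ψ₂ w, ratSum ψ₁ w, Or.inr h, by ring⟩
  have hzero : ∀ ψ : E → ℚ, ∀ w', (∀ e ∈ supp w', ψ e = 0) → ratSum ψ w' = 0 := by
    intro ψ w' h
    rw [ratSum_congr (ψ := fun e => 0 * ψ e) (by simpa using h), ratSum_const_mul, zero_mul]
  have hval : ∀ w', ratSum (fun e => a * ψ₁ e + b * ψ₂ e) w' =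
      a * ratSum ψ₁ w' + b * ratSum ψ₂ w' := fun w' => by
    rw [ratSum_add, ratSum_const_mul, ratSum_const_mul]
  obtain ⟨k, hk⟩ := hA (fun e => a * ψ₁ e + b * ψ₂ e) fun w' hw' => by
    rw [hval]
    by_cases hww : w' = w
    · rw [hww, h0]
    · rcases hR w' (hR' w' hw' hww) with ⟨h3, h4⟩ | ⟨h3, h4⟩
      · have e1 : ratSum ψ₁ w' = 0 := by
          rw [← hφ₁ w' h3]
          exact ratSum_congr fun e he => by simp [hψ₁, h4 he]
        have e2 : ratSum ψ₂ w' = 0 := hzero _ _ fun e he => by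
          simp [hψ₂, Finset.disjoint_left.1 hd (h4 he)]
        simp [e1, e2]
      · have e1 : ratSum ψ₂ w' = 0 := by
          rw [← hφ₂ w' h3]
          exact ratSum_congr fun e he => by simp [hψ₂, h4 he]
        have e2 : ratSum ψ₁ w' = 0 := hzero _ _ fun e he => by
          simp [hψ₁, Finset.disjoint_right.1 hd (h4 he)]
        simp [e1, e2]
  rcases hab with ha | hb
  · refine h1 ⟨fun v => k v / a, fun e he => ?_⟩
    have := hk e (hA₁ he)
    simp only [hψ₁, hψ₂, he, Finset.disjoint_left.1 hd he, if_true, if_false] at this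
    field_simp
    linarith
  · refine h2 ⟨fun v => k v / b, fun e he => ?_⟩
    have := hk e (hA₂ he)
    simp only [hψ₁, hψ₂, he, Finset.disjoint_right.1 hd he, if_true, if_false] at this
    field_simp
    linarith

theorem Staggered.not_bridge_side {R : Finset (FreeGroup E)}
    (hR : Staggered src tgt (R : Set (FreeGroup E)))
    (ih : ∀ R' ⊂ R, ∀ A' : Finset E, (∀ w' ∈ R', supp w' ⊆ A') →
      QAcyclic src tgt A' (R' : Set (FreeGroup E)) →
      Forest src tgt (collapsed A' (R' : Set (FreeGroup E))))
    {A : Finset E} {w : FreeGroup E} (hw : w ∈ R) (hwA : supp w ⊆ A) {e : E} (he : e ∈ supp w)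
    (hmin : ∀ w' ∈ R, w' ≠ w → ∀ f, IsLeast (supp w' : Set E) f → f ∉ supp w)
    {s : V → Prop} (hes : s (src e) ↔ ¬ s (tgt e))
    (hs : ∀ e' ∈ A, e' ≠ e → (s (src e') ↔ s (tgt e')))
    {R₁ : Finset (FreeGroup E)} (hR₁ : R₁ ⊆ R) (hwR₁ : w ∉ R₁)
    {A₁ : Finset E} (hA₁ : ∀ e', e' ∈ A₁ ↔ e' ∈ A ∧ e' ≠ e ∧ s (src e'))
    (hRA : ∀ w' ∈ R₁, supp w' ⊆ A₁)
    (hQ : QAcyclic src tgt A₁ (R₁ : Set (FreeGroup E))) : False := by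
  obtain ⟨v, hv⟩ := hR.loop w hw
  have hF := ih R₁ (Finset.ssubset_iff_subset_ne.2 ⟨hR₁, fun h => hwR₁ (h ▸ hw)⟩) A₁ hRA hQ
  obtain ⟨g, hg⟩ := hF.exists_potential of
  refine hv.not_bridge (hR.isCyclicallyReduced w hw) he (fun e' he' => hs e' (hwA he')) hes
    (g := g) fun e' he' hne hse => hg e' (mem_collapsed.2 ⟨(hA₁ e').2 ⟨hwA he', hne, hse⟩, ?_⟩)
  exact fun w' hw' hl => hmin w' (hR₁ hw') (fun h => hwR₁ (h ▸ hw')) e' hl he'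

theorem Staggered.not_bridge {R : Finset (FreeGroup E)}
    (hR : Staggered src tgt (R : Set (FreeGroup E)))
    (ih : ∀ R' ⊂ R, ∀ A' : Finset E, (∀ w' ∈ R', supp w' ⊆ A') →
      QAcyclic src tgt A' (R' : Set (FreeGroup E)) →
      Forest src tgt (collapsed A' (R' : Set (FreeGroup E))))
    {A : Finset E} (hRA : ∀ w' ∈ R, supp w' ⊆ A) (hQ : QAcyclic src tgt A (R : Set (FreeGroup E)))
    {w : FreeGroup E} (hw : w ∈ R) {e : E} (he : e ∈ supp w)
    (hmax : ∀ w' ∈ R, w' ≠ w → e ∉ supp w')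
    (hmin : ∀ w' ∈ R, w' ≠ w → ∀ f, IsLeast (supp w' : Set E) f → f ∉ supp w)
    {h : V → ℚ} (hh : ∀ e' ∈ A, (if e' = e then 1 else 0 : ℚ) = h (tgt e') - h (src e')) :
    False := by
  classical
  obtain ⟨s, hes, hside⟩ : ∃ s : V → Prop, (s (src e) ↔ ¬ s (tgt e)) ∧
      ∀ e' ∈ A, e' ≠ e → (s (src e') ↔ s (tgt e')) := by
    refine ⟨fun v => h v = h (tgt e), ?_, fun e' he' h' => ?_⟩
    · simp only [not_true, iff_false]
      intro h'
      have := hh e (hRA w hw he)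
      simp [h'] at this
    · have := hh e' he'
      rw [if_neg h'] at this
      have : h (src e') = h (tgt e') := by linarith
      simp [this]
  obtain ⟨s', hs'⟩ : ∃ s' : V → Prop, ∀ v, s' v ↔ ¬ s v := ⟨_, fun _ => Iff.rfl⟩
  set B : (V → Prop) → Finset E := fun s => A.filter fun e' => e' ≠ e ∧ s (src e') with hB
  set Q : (V → Prop) → Finset (FreeGroup E) := fun s =>
    R.filter fun w' => w' ≠ w ∧ supp w' ⊆ B s with hQdef
  have hcases : QAcyclic src tgt (B s) (Q s : Set (FreeGroup E)) ∨
      QAcyclic src tgt (B s') (Q s' : Set (FreeGroup E)) := by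
    refine hQ.side (w := w) (R' := {w' | w' ∈ R ∧ w' ≠ w}) (fun w' h1 h2 => ⟨h1, h2⟩)
      (Finset.filter_subset _ _) (Finset.filter_subset _ _) ?_ ?_
    · rw [Finset.disjoint_left]
      intro e' h1 h2
      simp only [hB, Finset.mem_filter] at h1 h2
      exact (hs' _).1 h2.2.2 h1.2.2
    · rintro w' ⟨h1, h2⟩
      obtain ⟨v, hv⟩ := hR.loop w' h1
      have h3 := hv.side (s := s) fun p hp => by
        have hp' : p.1 ∈ supp w' := mem_supp.2 ⟨p.2, hp⟩
        exact hside _ (hRA w' h1 hp') fun h' => hmax w' h1 h2 (h' ▸ hp')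
      by_cases hsv : s v
      · have : supp w' ⊆ B s := fun e' he' => by
          obtain ⟨b, hb⟩ := mem_supp.1 he'
          simp only [hB, Finset.mem_filter]
          exact ⟨hRA w' h1 he', fun h' => hmax w' h1 h2 (h' ▸ he'), (h3 _ hb).2 hsv⟩
        exact Or.inl ⟨by simp [hQdef, h1, h2, this], this⟩
      · have : supp w' ⊆ B s' := fun e' he' => by
          obtain ⟨b, hb⟩ := mem_supp.1 he'
          simp only [hB, Finset.mem_filter]
          exact ⟨hRA w' h1 he', fun h' => hmax w' h1 h2 (h' ▸ he'), (hs' _).2 fun h' => hsv ((h3 _ hb).1 h')⟩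
        exact Or.inr ⟨by simp [hQdef, h1, h2, this], this⟩
  have hmemQ : ∀ s w', w' ∈ Q s → supp w' ⊆ B s := fun s w' hw' => by
    simp only [hQdef, Finset.mem_filter] at hw'
    exact hw'.2.2
  rcases hcases with h1 | h1
  · exact hR.not_bridge_side ih hw (hRA w hw) he hmin (s := s) hes hside
      (Finset.filter_subset _ _) (by simp) (A₁ := B s) (by simp [hB]) (hmemQ _) h1
  · exact hR.not_bridge_side ih hw (hRA w hw) he hmin (s := s') (by rw [hs', hs']; exact not_congr hes)
      (fun e' h2 h3 => by rw [hs', hs']; exact not_congr (hside e' h2 h3))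
      (Finset.filter_subset _ _) (by simp) (A₁ := B s') (by simp [hB]) (hmemQ _) h1

/-- A rationally acyclic staggered complex has trivial nonabelian cohomology, and becomes a forest
when the smallest edge of each relator is removed. -/
theorem Staggered.collapse {R : Finset (FreeGroup E)}
    (hR : Staggered src tgt (R : Set (FreeGroup E))) {A : Finset E}
    (hRA : ∀ w ∈ R, supp w ⊆ A) (hQ : QAcyclic src tgt A (R : Set (FreeGroup E))) :
    (∀ (H : Type u) [Group H] (a : E → H), (∀ w ∈ R, lift a w = 1) →
      ∃ g : V → H, ∀ e ∈ A, a e = (g (src e))⁻¹ * g (tgt e)) ∧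
    Forest src tgt (collapsed A (R : Set (FreeGroup E))) := by
  classical
  induction R using Finset.strongInduction generalizing A with
  | H R ih =>
  rcases R.eq_empty_or_nonempty with rfl | hne
  · have hA : Forest src tgt A := fun φ => hQ φ (by simp)
    exact ⟨fun H _ a _ => hA.exists_potential a, hA.mono (collapsed_subset _ _)⟩
  obtain ⟨w, hw, e, he, hwe⟩ := hR.exists_greatest hne
  obtain ⟨v, hv⟩ := hR.loop w hw
  obtain ⟨n, hn, hpow⟩ := exists_eq_zpow_of_potential hv e
  have hn0 : n ≠ 0 := by
    rintro rfl
    obtain ⟨h, hh⟩ := hQ (fun e' => if e' = e then 1 else 0) fun w' hw' => by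
      by_cases h1 : w' = w
      · rw [h1, ← hn]
        simp
      · rw [ratSum_congr (ψ := fun _ => 0 * 0), ratSum_const_mul, zero_mul]
        intro e' he'
        rw [if_neg]
        · simp
        · rintro rfl
          exact (hwe w' hw' h1).1 he'
    exact hR.not_bridge (fun R' hR' A' h1 h2 =>
      (ih R' hR' (hR.mono (by exact_mod_cast hR'.1)) h1 h2).2) hRA hQ hw he
      (fun w' h1 h2 => (hwe w' h1 h2).1) (fun w' h1 h2 => (hwe w' h1 h2).2) hh
  have hn0' : (n : ℚ) ≠ 0 := by exact_mod_cast hn0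
  have hsum : ∀ (φ : E → ℚ) (c : ℚ), ratSum (fun e' => φ e' + c * if e' = e then 1 else 0) w =
      ratSum φ w + c * n := fun φ c => by rw [ratSum_add, ratSum_const_mul, hn]
  have hne' : ∀ w' ∈ R.erase w, w' ∈ R ∧ w' ≠ w := fun w' hw' =>
    ⟨Finset.mem_of_mem_erase hw', Finset.ne_of_mem_erase hw'⟩
  have hQ' : QAcyclic src tgt (A.erase e) (R.erase w : Finset _) := by
    intro φ hφ
    obtain ⟨h, hh⟩ := hQ (fun e' => φ e' + (- ratSum φ w / n) * if e' = e then 1 else 0)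
      fun w' hw' => by
        by_cases h1 : w' = w
        · rw [h1, hsum]
          field_simp
          ring
        · refine (ratSum_congr fun e' he' => ?_).trans
            (hφ w' (Finset.mem_coe.2 (Finset.mem_erase.2 ⟨h1, hw'⟩)))
          rw [if_neg]
          · simp
          · rintro rfl
            exact (hwe w' hw' h1).1 he'
    refine ⟨h, fun e' he' => ?_⟩
    rw [← hh e' (Finset.mem_of_mem_erase he'), if_neg (Finset.ne_of_mem_erase he')]
    simp
  obtain ⟨ih1, ih2⟩ := ih (R.erase w) (Finset.erase_ssubset hw)
    (hR.mono (by exact_mod_cast Finset.erase_subset _ _)) (A := A.erase e)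
    (fun w' hw' e' he' => Finset.mem_erase.2 ⟨by
      rintro rfl
      exact (hwe w' (hne' w' hw').1 (hne' w' hw').2).1 he', hRA w' (hne' w' hw').1 he'⟩) hQ'
  set T := collapsed (A.erase e) (R.erase w : Finset _) with hT
  have hwT : ∀ e' ∈ supp w, e' ≠ e → e' ∈ T := fun e' he' h1 => by
    rw [hT, mem_collapsed]
    refine ⟨Finset.mem_erase.2 ⟨h1, hRA w hw he'⟩, fun w' hw' hl => ?_⟩
    exact (hwe w' (hne' w' hw').1 (hne' w' hw').2).2 e' hl he'
  have hn1 : n = 1 ∨ n = -1 := by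
    obtain ⟨g, hg⟩ := ih2.exists_potential of
    have h1 := hpow (FreeGroup E) of g fun e' h2 h3 => hg e' (hwT e' h2 h3)
    rw [lift_of_eq_id, MonoidHom.id_apply] at h1
    rcases Int.eq_nat_or_neg n with ⟨m, rfl | rfl⟩
    · rw [zpow_natCast] at h1
      have := hR.not_proper_power w hw _ _ h1
      simp [this]
    · rw [zpow_neg, ← inv_zpow, zpow_natCast] at h1
      have := hR.not_proper_power w hw _ _ h1
      simp [this]
  constructor
  · intro H _ a ha
    obtain ⟨g, hg⟩ := ih1 H a fun w' hw' => ha w' (hne' w' hw').1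
    have h1 := hpow H a g fun e' h2 h3 => hg e' (Finset.mem_erase.2 ⟨h3, hRA w hw h2⟩)
    rw [ha w hw] at h1
    refine ⟨g, fun e' he' => ?_⟩
    by_cases h2 : e' = e
    · subst h2
      have h3 : (g v)⁻¹ * (g (src e') * a e' * (g (tgt e'))⁻¹) * g v = 1 := by
        rcases hn1 with rfl | rfl
        · rw [h1, zpow_one]
        · rw [zpow_neg_one] at h1
          exact inv_eq_one.1 h1.symm
      have h4 : g (src e') * a e' * (g (tgt e'))⁻¹ = 1 := by
        have := congrArg (fun x => g v * x * (g v)⁻¹) h3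
        simpa [mul_assoc] using this
      rw [mul_inv_eq_one] at h4
      rw [← h4]
      group
    · exact hg e' (Finset.mem_erase.2 ⟨h2, he'⟩)
  · -- a cocycle that is a coboundary on `T` and kills `w` is a coboundary on `e` too
    have hext : ∀ (φ : E → ℚ) (h : V → ℚ), (∀ e' ∈ T, φ e' = h (tgt e') - h (src e')) →
        ratSum φ w = 0 → φ e = h (tgt e) - h (src e) := by
      intro φ h hh h0
      have h1 := hv.ratSum_eq (φ := φ) (h := h)
        (ψ := fun e' => (φ e - (h (tgt e) - h (src e))) * if e' = e then 1 else 0) fun e' he' => by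
          by_cases h2 : e' = e
          · subst h2
            simp
          · rw [hh e' (hwT e' he' h2)]
            simp [h2]
      rw [ratSum_const_mul, ← hn, h0] at h1
      have : (φ e - (h (tgt e) - h (src e))) * n = 0 := by linarith
      have := (mul_eq_zero.1 this).resolve_right hn0'
      linarith
    have hsub : ∀ e' ∈ collapsed A (R : Set (FreeGroup E)), e' ≠ e → e' ∈ T := fun e' he' h1 => by
      rw [mem_collapsed] at he'
      rw [hT, mem_collapsed]
      exact ⟨Finset.mem_erase.2 ⟨h1, he'.1⟩, fun w' hw' => he'.2 w' (hne' w' hw').1⟩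
    set f := (supp w).min' ⟨e, he⟩ with hf
    have hfl : IsLeast (supp w : Set E) f := Finset.isLeast_min' _ _
    have hfnot : ∀ e' ∈ collapsed A (R : Set (FreeGroup E)), e' ≠ f := fun e' he' h1 => by
      rw [mem_collapsed] at he'
      exact he'.2 w hw (h1 ▸ hfl)
    by_cases hfe : f = e
    · exact ih2.mono fun e' he' => hsub e' he' (hfe ▸ hfnot e' he')
    by_cases hnf : ratSum (fun e' => if e' = f then 1 else 0) w = 0
    · exfalso
      obtain ⟨h, hh⟩ := ih2 fun e' => if e' = f then 1 else 0
      have hhe := hext _ h hh hnf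
      rw [if_neg (Ne.symm hfe)] at hhe
      have hhf := hh f (hwT f hfl.1 hfe)
      rw [if_pos rfl] at hhf
      obtain ⟨g, hg⟩ := ih2.exists_potential of
      obtain ⟨β, hβ, hβe⟩ : ∃ β, (β = h (src f) ∨ β = h (tgt f)) ∧ h (src e) ≠ β := by
        by_cases h1 : h (src e) = h (src f)
        · exact ⟨h (tgt f), Or.inr rfl, by rw [h1]; intro h2; rw [h2] at hhf; simp at hhf⟩
        · exact ⟨h (src f), Or.inl rfl, h1⟩
      refine hv.not_bridge (hR.isCyclicallyReduced w hw) hfl.1 (s := fun v => h v = β) (g := g)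
        (fun e' he' h1 => ?_) ?_ fun e' he' h1 h2 => hg e' (hwT e' he' ?_)
      · have : h (src e') = h (tgt e') := by
          by_cases h2 : e' = e
          · subst h2
            linarith
          · have := hh e' (hwT e' he' h2)
            rw [if_neg h1] at this
            linarith
        simp [this]
      · rcases hβ with rfl | rfl
        · simp only [true_iff]
          intro h2
          linarith
        · simp only [not_true, iff_false]
          intro h2
          linarith
      · rintro rfl
        exact hβe h2
    · intro φ
      set c := - ratSum φ w / ratSum (fun e' => if e' = f then 1 else 0) w with hc
      obtain ⟨h, hh⟩ := ih2 fun e' => φ e' + c * if e' = f then 1 else 0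
      have hhe := hext _ h hh (by
        rw [ratSum_add, ratSum_const_mul, hc]
        field_simp
        ring)
      refine ⟨h, fun e' he' => ?_⟩
      have h1 := hfnot e' he'
      by_cases h2 : e' = e
      · subst h2
        rw [← hhe, if_neg h1]
        simp
      · rw [← hh e' (hsub e' he' h2), if_neg h1]
        simp

end

section Lift

variable {E : Type*} (φ : E → ℚ)

/-- The lift of a word to the abelian cover defined by `φ`, starting at level `q`. -/
def liftList : ℚ → List (E × Bool) → List ((E ×ₗ ℚ) × Bool)
  | _, [] => []
  | q, p :: L => (toLex (p.1, cond p.2 q (q - φ p.1)), p.2) ::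
      liftList (cond p.2 (q + φ p.1) (q - φ p.1)) L

theorem ratSum_mk_cons (p : E × Bool) (L : List (E × Bool)) :
    ratSum φ (mk (p :: L)) = cond p.2 (φ p.1) (- φ p.1) + ratSum φ (mk L) := by
  obtain ⟨e, b⟩ := p
  cases b <;> simp [ratSum, lift_mk]

theorem ratSum_mk_nil : ratSum φ (mk []) = 0 := ratSum_one φ

theorem liftList_append (q : ℚ) (L₁ L₂ : List (E × Bool)) :
    liftList φ q (L₁ ++ L₂) = liftList φ q L₁ ++ liftList φ (q + ratSum φ (mk L₁)) L₂ := by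
  induction L₁ generalizing q with
  | nil => simp [liftList, ratSum_mk_nil]
  | cons p L₁ ih =>
    simp only [List.cons_append, liftList, ih, ratSum_mk_cons]
    obtain ⟨e, b⟩ := p
    cases b <;> simp [add_assoc, sub_eq_add_neg]

theorem map_liftList (q : ℚ) (L : List (E × Bool)) :
    (liftList φ q L).map (Prod.map (fun x => (ofLex x).1) id) = L := by
  induction L generalizing q with
  | nil => rfl
  | cons p L ih => simp [liftList, ih]

theorem length_liftList (q : ℚ) (L : List (E × Bool)) : (liftList φ q L).length = L.length := by
  have := congrArg List.length (map_liftList φ q L)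
  simpa using this

theorem mem_liftList_shift {q : ℚ} {L : List (E × Bool)} {e : E} {r : ℚ} {b : Bool}
    (h : (toLex (e, r), b) ∈ liftList φ q L) (δ : ℚ) :
    (toLex (e, r + δ), b) ∈ liftList φ (q + δ) L := by
  induction L generalizing q with
  | nil => simp [liftList] at h
  | cons p L ih =>
    obtain ⟨e', b'⟩ := p
    simp only [liftList, List.mem_cons, Prod.mk.injEq, EmbeddingLike.apply_eq_iff_eq] at h ⊢
    rcases h with ⟨⟨rfl, rfl⟩, rfl⟩ | h
    · left
      cases b <;> simp
      ring
    · right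
      have := ih h
      cases b' <;> simpa [add_right_comm, add_sub_right_comm] using this

theorem IsReduced.of_map {α β : Type*} {f : α → β} {L : List (α × Bool)}
    (h : IsReduced (L.map (Prod.map f id))) : IsReduced L :=
  List.isChain_of_isChain_map _ (fun _ _ h' h'' => h' (congrArg f h'')) h

theorem IsCyclicallyReduced.of_map {α β : Type*} {f : α → β} {L : List (α × Bool)}
    (h : IsCyclicallyReduced (L.map (Prod.map f id))) : IsCyclicallyReduced L := by
  rw [isCyclicallyReduced_iff] at h ⊢
  refine ⟨h.1.of_map, fun a ha b hb hab => ?_⟩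
  refine h.2 (Prod.map f id a) ?_ (Prod.map f id b) ?_ (congrArg f hab)
  · rw [List.getLast?_map]
    exact Option.mem_map_of_mem _ ha
  · rw [List.head?_map]
    exact Option.mem_map_of_mem _ hb

theorem IsWalk.liftList {V : Type*} {src tgt : E → V} {v v' : V} {L : List (E × Bool)}
    (h : IsWalk src tgt v L v') (q : ℚ) :
    IsWalk (fun x : E ×ₗ ℚ => (src (ofLex x).1, (ofLex x).2))
      (fun x : E ×ₗ ℚ => (tgt (ofLex x).1, (ofLex x).2 + φ (ofLex x).1))
      (v, q) (liftList φ q L) (v', q + ratSum φ (mk L)) := by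
  induction L generalizing v q with
  | nil =>
    obtain rfl : v = v' := h
    simp [FreeGroup.liftList, IsWalk, ratSum_mk_nil]
  | cons p L ih =>
    obtain ⟨h1, h2⟩ := h
    obtain ⟨e, b⟩ := p
    rw [ratSum_mk_cons]
    cases b
    · refine ⟨by simpa using h1, ?_⟩
      have := ih h2 (q - φ e)
      simpa [sub_eq_add_neg, add_assoc] using this
    · refine ⟨by simpa using h1, ?_⟩
      have := ih h2 (q + φ e)
      simpa [sub_eq_add_neg, add_assoc] using this

variable [DecidableEq E]

/-- The lift of an element to the abelian cover defined by `φ`, starting at level `q`. -/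
def liftAt (q : ℚ) (x : FreeGroup E) : FreeGroup (E ×ₗ ℚ) := mk (liftList φ q x.toWord)

theorem mk_liftList (q : ℚ) (L : List (E × Bool)) :
    mk (liftList φ q L) = liftAt φ q (mk L) := by
  have hstep : ∀ L L' : List (E × Bool), Red.Step L L' →
      mk (liftList φ q L) = mk (liftList φ q L') := by
    rintro _ _ @⟨L₁, L₂, e, b⟩
    refine Quot.sound ?_
    cases b <;> simp only [liftList_append, liftList, cond_true, cond_false, Bool.not_true,
      Bool.not_false, sub_add_cancel, add_sub_cancel_right]
    · exact Red.Step.not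
    · exact Red.Step.not
  have hred : ∀ L L' : List (E × Bool), Red L L' →
      mk (liftList φ q L) = mk (liftList φ q L') := by
    intro L L' h
    induction h with
    | refl => rfl
    | tail _ h ih => rw [ih, hstep _ _ h]
  rw [liftAt, toWord_mk]
  exact hred _ _ reduce.red

theorem liftAt_mul (q : ℚ) (x y : FreeGroup E) :
    liftAt φ q (x * y) = liftAt φ q x * liftAt φ (q + ratSum φ x) y := by
  conv_lhs => rw [← mk_toWord (x := x), ← mk_toWord (x := y), mul_mk, ← mk_liftList,
    liftList_append, ← mul_mk, mk_liftList, mk_liftList]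
  simp [mk_toWord]

@[simp] theorem liftAt_one (q : ℚ) : liftAt φ q 1 = 1 := by
  simp [liftAt, liftList, one_eq_mk]

theorem liftAt_inv (q : ℚ) (x : FreeGroup E) :
    liftAt φ q x⁻¹ = (liftAt φ (q - ratSum φ x) x)⁻¹ := by
  rw [eq_inv_iff_mul_eq_one]
  have := liftAt_mul φ q x⁻¹ x
  simpa [← sub_eq_add_neg] using this.symm

theorem liftAt_zpow {x : FreeGroup E} (hx : ratSum φ x = 0) (q : ℚ) (n : ℤ) :
    liftAt φ q (x ^ n) = liftAt φ q x ^ n := by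
  induction n with
  | zero => simp
  | succ n ih => rw [zpow_add_one, zpow_add_one, liftAt_mul, ratSum_zpow, hx, ih]; simp
  | pred n ih =>
    rw [zpow_sub_one, zpow_sub_one, liftAt_mul, ratSum_zpow, hx, ih, liftAt_inv, hx]
    simp

theorem liftAt_lift {ι : Type*} {u : ι → FreeGroup E} (hu : ∀ i, ratSum φ (u i) = 0) (q : ℚ)
    (x : FreeGroup ι) : liftAt φ q (lift u x) = lift (fun i => liftAt φ q (u i)) x := by
  have h0 : ∀ x, ratSum φ (lift u x) = 0 := fun x => by
    rw [ratSum_lift, show (fun i => ratSum φ (u i)) = fun i => 0 * 0 by ext i; simp [hu],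
      ratSum_const_mul, zero_mul]
  induction x using FreeGroup.induction_on with
  | C1 => simp
  | of i => simp
  | inv_of i _ => simp [liftAt_inv, hu]
  | mul x y hx hy => simp [liftAt_mul, hx, hy, h0]

theorem liftAt_prod (q : ℚ) (L : List (FreeGroup E)) (hL : ∀ x ∈ L, ratSum φ x = 0) :
    liftAt φ q L.prod = (L.map (liftAt φ q)).prod := by
  induction L with
  | nil => simp
  | cons x L ih =>
    rw [List.prod_cons, liftAt_mul, hL x List.mem_cons_self, add_zero,
      ih fun y hy => hL y (List.mem_cons_of_mem _ hy)]
    simp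

theorem toWord_liftAt (q : ℚ) (x : FreeGroup E) :
    (liftAt φ q x).toWord = liftList φ q x.toWord := by
  rw [liftAt, toWord_mk]
  refine IsReduced.reduce_eq (IsReduced.of_map (f := fun x => (ofLex x).1) ?_)
  rw [map_liftList]
  exact isReduced_toWord

theorem map_liftAt (q : ℚ) (x : FreeGroup E) :
    map (fun x => (ofLex x).1) (liftAt φ q x) = x := by
  rw [liftAt, map.mk]
  conv_rhs => rw [← mk_toWord (x := x)]
  congr 1
  conv_rhs => rw [← map_liftList φ q x.toWord]
  rfl

theorem norm_liftAt (q : ℚ) (x : FreeGroup E) : (liftAt φ q x).norm = x.norm := by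
  rw [norm, toWord_liftAt, length_liftList, norm]

theorem image_supp_liftAt (q : ℚ) (x : FreeGroup E) :
    (supp (liftAt φ q x)).image (fun x => (ofLex x).1) = supp x := by
  have := map_liftList φ q x.toWord
  conv_rhs => rw [supp, ← this]
  rw [supp, toWord_liftAt]
  ext e
  simp

theorem mem_supp_liftAt_shift {q : ℚ} {x : FreeGroup E} {e : E} {r : ℚ}
    (h : toLex (e, r) ∈ supp (liftAt φ q x)) (δ : ℚ) :
    toLex (e, r + δ) ∈ supp (liftAt φ (q + δ) x) := by
  obtain ⟨b, hb⟩ := mem_supp.1 h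
  rw [toWord_liftAt] at hb
  refine mem_supp.2 ⟨b, ?_⟩
  rw [toWord_liftAt]
  exact mem_liftList_shift φ hb δ

end Lift

section

variable {V E : Type u} [LinearOrder E] {src tgt : E → V}

theorem stagLT_liftAt_self (φ : E → ℚ) {w : FreeGroup E} (hw : w ≠ 1) {q q' : ℚ} (h : q < q') :
    StagLT (liftAt φ q w) (liftAt φ q' w) := by
  have hne : (supp (liftAt φ q w)).Nonempty := by
    have := supp_nonempty hw
    rw [← image_supp_liftAt φ q] at this
    exact Finset.image_nonempty.1 this
  have hlt : ∀ (e : E) (r : ℚ), toLex (e, r) < toLex (e, r + (q' - q)) := fun e r => by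
    rw [Prod.Lex.toLex_lt_toLex]
    exact Or.inr ⟨rfl, by simp; linarith⟩
  constructor
  · obtain ⟨m, hm, hmax⟩ := (supp (liftAt φ q w)).exists_max_image id hne
    have := mem_supp_liftAt_shift φ (e := (ofLex m).1) (r := (ofLex m).2) hm (q' - q)
    rw [add_sub_cancel] at this
    exact ⟨_, this, fun e he => (hmax e he).trans_lt (hlt _ _)⟩
  · obtain ⟨m, hm, hmin⟩ := (supp (liftAt φ q w)).exists_min_image id hne
    refine ⟨m, hm, fun e he => ?_⟩
    have := mem_supp_liftAt_shift φ (e := (ofLex e).1) (r := (ofLex e).2) he (q - q')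
    rw [add_sub_cancel] at this
    refine (hmin _ this).trans_lt ?_
    have h2 := hlt (ofLex e).1 ((ofLex e).2 + (q - q'))
    have h3 : (ofLex e).2 + (q - q') + (q' - q) = (ofLex e).2 := by ring
    rw [h3] at h2
    exact h2

theorem StagLT.lift_cover (φ : E → ℚ) {w w' : FreeGroup E} (h : StagLT w w') (q q' : ℚ) :
    StagLT (liftAt φ q w) (liftAt φ q' w') := by
  have hproj : ∀ (q : ℚ) (x : FreeGroup E), ∀ e ∈ supp (liftAt φ q x),
      (ofLex e).1 ∈ supp x := fun q x e he => by
    rw [← image_supp_liftAt φ q]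
    exact Finset.mem_image_of_mem _ he
  have hex : ∀ (q : ℚ) (x : FreeGroup E), ∀ e ∈ supp x,
      ∃ e' ∈ supp (liftAt φ q x), (ofLex e').1 = e := fun q x e he => by
    rw [← image_supp_liftAt φ q] at he
    exact Finset.mem_image.1 he
  have hlt : ∀ a b : E ×ₗ ℚ, (ofLex a).1 < (ofLex b).1 → a < b := fun a b hab => by
    rw [Prod.Lex.lt_iff]
    exact Or.inl hab
  obtain ⟨⟨e, he, h1⟩, f, hf, h2⟩ := h
  constructor
  · obtain ⟨e', he', rfl⟩ := hex q' w' e he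
    exact ⟨e', he', fun x hx => hlt _ _ (h1 _ (hproj _ _ x hx))⟩
  · obtain ⟨f', hf', rfl⟩ := hex q w f hf
    exact ⟨f', hf', fun x hx => hlt _ _ (h2 _ (hproj _ _ x hx))⟩

theorem IsWalk.lift_cover (φ : E → ℚ) {v v' : V} {x : FreeGroup E}
    (h : IsWalk src tgt v x.toWord v') (q : ℚ) :
    IsWalk (fun x : E ×ₗ ℚ => (src (ofLex x).1, (ofLex x).2))
      (fun x : E ×ₗ ℚ => (tgt (ofLex x).1, (ofLex x).2 + φ (ofLex x).1))
      (v, q) (liftAt φ q x).toWord (v', q + ratSum φ x) := by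
  have := h.liftList φ q
  rwa [mk_toWord, ← toWord_liftAt] at this

theorem Staggered.lift_cover {R : Set (FreeGroup E)} (hR : Staggered src tgt R) {φ : E → ℚ}
    (hφ : ∀ w ∈ R, ratSum φ w = 0) :
    Staggered (fun x : E ×ₗ ℚ => (src (ofLex x).1, (ofLex x).2))
      (fun x : E ×ₗ ℚ => (tgt (ofLex x).1, (ofLex x).2 + φ (ofLex x).1))
      {x | ∃ w ∈ R, ∃ q, x = liftAt φ q w} where
  isCyclicallyReduced := by
    rintro _ ⟨w, hw, q, rfl⟩
    refine IsCyclicallyReduced.of_map (f := fun x => (ofLex x).1) ?_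
    rw [toWord_liftAt, map_liftList]
    exact hR.isCyclicallyReduced w hw
  not_proper_power := by
    rintro _ ⟨w, hw, q, rfl⟩ c m h
    refine hR.not_proper_power w hw (map (fun x => (ofLex x).1) c) m ?_
    rw [← map_pow, ← h, map_liftAt]
  loop := by
    rintro _ ⟨w, hw, q, rfl⟩
    obtain ⟨v, hv⟩ := hR.loop w hw
    have := hv.lift_cover φ q
    rw [hφ w hw, add_zero] at this
    exact ⟨_, this⟩
  stag := by
    rintro _ ⟨w, hw, q, rfl⟩ _ ⟨w', hw', q', rfl⟩ hne
    by_cases h : w = w'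
    · subst h
      rcases lt_trichotomy q q' with h | h | h
      · exact Or.inl (stagLT_liftAt_self φ (hR.ne_one hw) h)
      · exact absurd (by rw [h]) hne
      · exact Or.inr (stagLT_liftAt_self φ (hR.ne_one hw) h)
    · exact (hR.stag w hw w' hw' h).imp (fun h => h.lift_cover φ q q') (fun h => h.lift_cover φ q' q)

end

section Tower

theorem mem_normalClosure_of_isWalk {V E : Type u} [LinearOrder E] {src tgt : E → V}
    {R : Set (FreeGroup E)} {a : E → FreeGroup E ⧸ Subgroup.normalClosure R}
    (ha : ∀ e, a e = QuotientGroup.mk (of e)) {g : V → FreeGroup E ⧸ Subgroup.normalClosure R}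
    {x : FreeGroup E} {v : V} (hx : IsWalk src tgt v x.toWord v)
    (hg : ∀ e ∈ supp x, a e = (g (src e))⁻¹ * g (tgt e)) : x ∈ Subgroup.normalClosure R := by
  have h1 := hx.lift_eq (a := a) (b := fun _ => 1) (g := g) fun e he => by
    rw [hg e he, mul_one]
  have h2 : lift a = QuotientGroup.mk' (Subgroup.normalClosure R) := by
    ext e
    simp [ha]
  have h3 : lift (fun _ : E => (1 : FreeGroup E ⧸ Subgroup.normalClosure R)) = 1 := by
    ext e
    simp
  rw [h2, h3] at h1
  rw [← QuotientGroup.eq_one_iff]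
  simpa using h1

/-- If a projection between finite vertex sets of an abelian cover is injective, then the cocycle
defining the cover is a coboundary. -/
theorem exists_coboundary_of_injOn {V E : Type*} {src tgt : E → V} {φ : E → ℚ} {A : Finset E}
    {B : Set (E ×ₗ ℚ)} (hB : ∀ e ∈ A, ∃ q, toLex (e, q) ∈ B) {W : Set (V × ℚ)}
    (hs : ∀ x ∈ B, (src (ofLex x).1, (ofLex x).2) ∈ W)
    (ht : ∀ x ∈ B, (tgt (ofLex x).1, (ofLex x).2 + φ (ofLex x).1) ∈ W)
    (hinj : Set.InjOn Prod.fst W) : ∃ h : V → ℚ, ∀ e ∈ A, φ e = h (tgt e) - h (src e) := by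
  classical
  have key : ∀ v : V, ∃ r : ℚ, ∀ q, (v, q) ∈ W → q = r := fun v => by
    by_cases h : ∃ q, (v, q) ∈ W
    · obtain ⟨r, hr⟩ := h
      exact ⟨r, fun q hq => congrArg Prod.snd (hinj hq hr rfl)⟩
    · push Not at h
      exact ⟨0, fun q hq => absurd hq (h q)⟩
  choose h hh using key
  refine ⟨h, fun e he => ?_⟩
  obtain ⟨q, hq⟩ := hB e he
  have h1 := hh _ _ (hs _ hq)
  have h2 := hh _ _ (ht _ hq)
  simp only [ofLex_toLex] at h1 h2
  rw [← h1, ← h2]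
  ring

variable {ι κ : Type*} [Fintype ι] [Fintype κ]

/-- The letters occurring in the words of a finite diagram. -/
def letters {E : Type*} [DecidableEq E] (u : ι → FreeGroup E) (g w : κ → FreeGroup E) :
    Finset E :=
  Finset.univ.biUnion (fun i => supp (u i)) ∪
    Finset.univ.biUnion (fun j => supp (g j) ∪ supp (w j))

/-- The total length of the words of a finite diagram. -/
def totalNorm {E : Type*} [DecidableEq E] (u : ι → FreeGroup E) (g w : κ → FreeGroup E) : ℕ :=
  ∑ i, (u i).norm + ∑ j, ((g j).norm + (w j).norm)

theorem card_letters_le {E : Type*} [DecidableEq E] (u : ι → FreeGroup E)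
    (g w : κ → FreeGroup E) : (letters u g w).card ≤ totalNorm u g w := by
  refine (Finset.card_union_le _ _).trans (add_le_add ?_ ?_)
  · exact Finset.card_biUnion_le.trans (Finset.sum_le_sum fun i _ => card_supp_le _)
  · exact Finset.card_biUnion_le.trans (Finset.sum_le_sum fun i _ =>
      (Finset.card_union_le _ _).trans (add_le_add (card_supp_le _) (card_supp_le _)))

theorem Staggered.mem_normalClosure_of_rational {c : ι → FreeGroup ι}
    (hc : ∀ φ : ι → ℚ, (∀ i, ratSum φ (c i) = 0) → ∀ i, φ i = 0) (l : ι → List κ) (k : κ → ℤ)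
    (n : ℕ) {V E : Type u} [LinearOrder E] [DecidableEq V] {src tgt : E → V}
    {R : Set (FreeGroup E)} (hR : Staggered src tgt R) {u : ι → FreeGroup E}
    {g w : κ → FreeGroup E}
    (hu : ∀ i, ∃ v, IsWalk src tgt v (u i).toWord v) (hw : ∀ j, w j ∈ R)
    (huc : ∀ i, lift u (c i) = ((l i).map fun j => g j * w j ^ k j * (g j)⁻¹).prod)
    (hn : 2 * totalNorm u g w <
      n + ((letters u g w).image src ∪ (letters u g w).image tgt).card) (i : ι) :
    u i ∈ Subgroup.normalClosure R := by
  classical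
  induction n generalizing V E with
  | zero =>
    have h1 := card_letters_le u g w
    have h2 := Finset.card_union_le ((letters u g w).image src) ((letters u g w).image tgt)
    have h3 := Finset.card_image_le (s := letters u g w) (f := src)
    have h4 := Finset.card_image_le (s := letters u g w) (f := tgt)
    omega
  | succ n ih =>
  set A := letters u g w with hA
  have huA : ∀ i, supp (u i) ⊆ A := fun i e he =>
    Finset.mem_union_left _ (Finset.mem_biUnion.2 ⟨i, Finset.mem_univ _, he⟩)
  have hwA : ∀ j, supp (w j) ⊆ A := fun j e he => Finset.mem_union_right _
    (Finset.mem_biUnion.2 ⟨j, Finset.mem_univ _, Finset.mem_union_right _ he⟩)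
  set R₀ : Finset (FreeGroup E) := Finset.univ.image w with hR₀
  have hR₀R : (R₀ : Set (FreeGroup E)) ⊆ R := fun x hx => by
    simp only [hR₀, Finset.coe_image, Finset.coe_univ, Set.image_univ, Set.mem_range] at hx
    obtain ⟨j, rfl⟩ := hx
    exact hw j
  have hwR₀ : ∀ j, w j ∈ (R₀ : Set (FreeGroup E)) := fun j => by simp [hR₀]
  have hS := hR.mono hR₀R
  by_cases hQ : QAcyclic src tgt A (R₀ : Set (FreeGroup E))
  · obtain ⟨h1, -⟩ := hS.collapse (fun x hx => by
      obtain ⟨j, -, rfl⟩ := Finset.mem_image.1 hx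
      exact hwA j) hQ
    obtain ⟨p, hp⟩ := h1 (FreeGroup E ⧸ Subgroup.normalClosure R)
      (fun e => QuotientGroup.mk (of e)) fun x hx => by
        have : lift (fun e => (QuotientGroup.mk (of e) : FreeGroup E ⧸ Subgroup.normalClosure R))
            = QuotientGroup.mk' (Subgroup.normalClosure R) := by
          ext e
          simp
        rw [this, QuotientGroup.mk'_apply, QuotientGroup.eq_one_iff]
        exact Subgroup.subset_normalClosure (hR₀R hx)
    obtain ⟨v, hv⟩ := hu i
    exact mem_normalClosure_of_isWalk (fun _ => rfl) hv fun e he => hp e (huA i he)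
  · simp only [QAcyclic, not_forall] at hQ
    obtain ⟨φ, hφ, hφA⟩ := hQ
    have hφu : ∀ i, ratSum φ (u i) = 0 := hc _ fun i => by
      rw [← ratSum_lift, huc]
      simp only [ratSum, map_list_prod, List.map_map]
      rw [List.prod_eq_one, toAdd_one]
      intro x hx
      obtain ⟨j, -, rfl⟩ := List.mem_map.1 hx
      apply Multiplicative.toAdd.injective
      have := hφ _ (hwR₀ j)
      rw [ratSum] at this
      simp [this]
    set g' : κ → FreeGroup (E ×ₗ ℚ) := fun j => liftAt φ 0 (g j) with hg'
    set w' : κ → FreeGroup (E ×ₗ ℚ) := fun j => liftAt φ (ratSum φ (g j)) (w j) with hw'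
    set u' : ι → FreeGroup (E ×ₗ ℚ) := fun i => liftAt φ 0 (u i) with hu'
    set A' := letters u' g' w' with hA'
    set src' : E ×ₗ ℚ → V × ℚ := fun x => (src (ofLex x).1, (ofLex x).2) with hsrc'
    set tgt' : E ×ₗ ℚ → V × ℚ := fun x => (tgt (ofLex x).1, (ofLex x).2 + φ (ofLex x).1)
      with htgt'
    have hnorm : totalNorm u' g' w' = totalNorm u g w := by
      simp [totalNorm, hu', hg', hw', norm_liftAt]
    have hAA' : A'.image (fun x => (ofLex x).1) = A := by
      simp only [hA', hA, letters, Finset.image_union, Finset.biUnion_image]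
      simp only [hu', hg', hw', image_supp_liftAt]
    have himg : (A'.image src' ∪ A'.image tgt').image Prod.fst = A.image src ∪ A.image tgt := by
      rw [← hAA']
      simp only [Finset.image_union, Finset.image_image]
      rfl
    have hcard : (A.image src ∪ A.image tgt).card < (A'.image src' ∪ A'.image tgt').card := by
      refine lt_of_le_of_ne (himg ▸ Finset.card_image_le) fun h => hφA ?_
      rw [← himg] at h
      refine exists_coboundary_of_injOn (B := (A' : Set (E ×ₗ ℚ))) (fun e he => ?_) (fun x hx => ?_)
        (fun x hx => ?_) (Finset.card_image_iff.1 h)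
      · rw [← hAA'] at he
        obtain ⟨x, hx, rfl⟩ := Finset.mem_image.1 he
        exact ⟨(ofLex x).2, hx⟩
      · exact Finset.mem_coe.2 (Finset.mem_union_left _ (Finset.mem_image_of_mem src' hx))
      · exact Finset.mem_coe.2 (Finset.mem_union_right _ (Finset.mem_image_of_mem tgt' hx))
    have hmem := ih (src := src') (tgt := tgt') (hS.lift_cover hφ) (u := u') (g := g') (w := w') (fun i => by
        obtain ⟨v, hv⟩ := hu i
        have := hv.lift_cover φ 0
        rw [hφu i, add_zero] at this
        exact ⟨_, this⟩)
      (fun j => ⟨_, hwR₀ j, _, rfl⟩) (fun i => by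
        rw [hu', ← liftAt_lift φ hφu, huc, liftAt_prod, List.map_map]
        · congr 1
          refine List.map_congr_left fun j _ => ?_
          simp [liftAt_mul, liftAt_inv, hφ _ (hwR₀ j), liftAt_zpow, hg', hw']
        · intro x hx
          obtain ⟨j, -, rfl⟩ := List.mem_map.1 hx
          simp [hφ _ (hwR₀ j)]) (by
        rw [hnorm]
        change _ < n + (A'.image src' ∪ A'.image tgt').card
        omega)
    have hle : (Subgroup.normalClosure {x | ∃ w ∈ (R₀ : Set (FreeGroup E)), ∃ q,
        x = liftAt φ q w}) ≤ (Subgroup.normalClosure R).comap (map fun x => (ofLex x).1) := by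
      refine Subgroup.normalClosure_le_normal ?_
      rintro _ ⟨x, hx, q, rfl⟩
      rw [SetLike.mem_coe, Subgroup.mem_comap, map_liftAt]
      exact Subgroup.subset_normalClosure (hR₀R hx)
    have := hle hmem
    rwa [Subgroup.mem_comap, map_liftAt] at this

end Tower

theorem isWalk_punit {E : Type*} (L : List (E × Bool)) (v v' : PUnit) :
    IsWalk (fun _ => PUnit.unit) (fun _ => PUnit.unit) v L v' := by
  induction L generalizing v with
  | nil => exact Subsingleton.elim _ _
  | cons p L ih => exact ⟨Subsingleton.elim _ _, ih _⟩

theorem exists_list_of_mem_normalClosure {G : Type*} [Group G] {w x : G}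
    (hx : x ∈ Subgroup.normalClosure {w}) :
    ∃ L : List (G × ℤ), x = (L.map fun p => p.1 * w ^ p.2 * p.1⁻¹).prod := by
  have hconj : ∀ y ∈ Group.conjugatesOfSet {w}, ∃ g : G, g * w * g⁻¹ = y := fun y hy =>
    isConj_iff.1 (by simpa using Group.mem_conjugatesOfSet_iff.1 hy)
  refine Subgroup.closure_induction_left
    (p := fun x _ => ∃ L : List (G × ℤ), x = (L.map fun p => p.1 * w ^ p.2 * p.1⁻¹).prod)
    ⟨[], by simp⟩ (fun y hy z _ hz => ?_) (fun y hy z _ hz => ?_) hx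
  · obtain ⟨L, hL⟩ := hz
    obtain ⟨g, hg⟩ := hconj y hy
    exact ⟨(g, 1) :: L, by simp [hL, hg]⟩
  · obtain ⟨L, hL⟩ := hz
    obtain ⟨g, hg⟩ := hconj y hy
    exact ⟨(g, -1) :: L, by simp [hL, ← hg, mul_assoc]⟩

theorem normalClosure_singleton_conj {G : Type*} [Group G] (g w : G) :
    Subgroup.normalClosure {g * w * g⁻¹} = Subgroup.normalClosure {w} := by
  have key : ∀ g w : G, Subgroup.normalClosure {g * w * g⁻¹} ≤ Subgroup.normalClosure {w} := by
    refine fun g w => Subgroup.normalClosure_le_normal (Set.singleton_subset_iff.2 ?_)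
    have h : w ∈ Subgroup.normalClosure {w} :=
      Subgroup.subset_normalClosure (Set.mem_singleton w)
    exact Subgroup.normalClosure_normal.conj_mem w h g
  refine le_antisymm (key g w) ?_
  have := key g⁻¹ (g * w * g⁻¹)
  rwa [show g⁻¹ * (g * w * g⁻¹) * g⁻¹⁻¹ = w by group] at this

theorem exists_conj_isCyclicallyReduced {S : Type*} [DecidableEq S] (w : FreeGroup S) :
    ∃ w' g : FreeGroup S, w = g * w' * g⁻¹ ∧ IsCyclicallyReduced w'.toWord := by
  refine ⟨mk (reduceCyclically w.toWord), mk (reduceCyclically.conjugator w.toWord), ?_, ?_⟩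
  · have := congrArg mk (reduceCyclically.conj_conjugator_reduceCyclically w.toWord)
    rwa [← mul_mk, ← mul_mk, ← inv_mk, mk_toWord, eq_comm] at this
  · have := reduceCyclically.isCyclicallyReduced (isReduced_toWord (x := w))
    rw [toWord_mk, this.isReduced.reduce_eq]
    exact this

/-- If the images of finitely many elements in a one-relator group generate a rationally perfect
subgroup, and the relator is not a proper power, then they are trivial. -/
theorem mem_normalClosure_of_rational {S : Type u} {w : FreeGroup S}
    (hw : ∀ (c : FreeGroup S) (m : ℕ), w = c ^ m → m = 1) {ι : Type*} [Fintype ι]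
    {c : ι → FreeGroup ι} (hc : ∀ φ : ι → ℚ, (∀ i, ratSum φ (c i) = 0) → ∀ i, φ i = 0)
    {u : ι → FreeGroup S} (hu : ∀ i, lift u (c i) ∈ Subgroup.normalClosure {w}) (i : ι) :
    u i ∈ Subgroup.normalClosure {w} := by
  let _ : LinearOrder S := IsWellOrder.linearOrder WellOrderingRel
  obtain ⟨w', g, hg, hcyc⟩ := exists_conj_isCyclicallyReduced w
  have hN : Subgroup.normalClosure {w} = Subgroup.normalClosure {w'} := by
    rw [hg, normalClosure_singleton_conj]
  rw [hN] at hu ⊢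
  have hS : Staggered (V := PUnit) (fun _ : S => PUnit.unit) (fun _ => PUnit.unit)
      ({w'} : Set (FreeGroup S)) := by
    refine ⟨?_, ?_, ?_, ?_⟩
    · rintro _ rfl
      exact hcyc
    · rintro _ rfl d m h
      refine hw (g * d * g⁻¹) m ?_
      rw [conj_pow, ← h, ← hg]
    · exact fun x _ => ⟨PUnit.unit, isWalk_punit _ _ _⟩
    · rintro _ rfl _ rfl h
      exact absurd rfl h
  choose L hL using fun i => exists_list_of_mem_normalClosure (hu i)
  refine hS.mem_normalClosure_of_rational (κ := Σ i, Fin (L i).length) hc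
    (fun i => (List.finRange (L i).length).map fun j => ⟨i, j⟩) (fun j => ((L j.1).get j.2).2)
    _ (u := u) (g := fun j => ((L j.1).get j.2).1) (w := fun _ => w')
    (fun i => ⟨PUnit.unit, isWalk_punit _ _ _⟩) (fun _ => rfl) (fun i => ?_)
    (Nat.lt_succ_self _ |>.trans_le (Nat.le_add_right _ _)) i
  rw [hL i, List.map_map]
  congr 1
  conv_lhs => rw [← List.map_get_finRange (L i), List.map_map]
  rfl

end FreeGroup

section

open scoped commutatorElement

theorem UniqueProds.of_ker {G H : Type*} [Group G] [Group H] (f : G →* H) [UniqueProds H]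
    [UniqueProds f.ker] : UniqueProds G := by
  classical
  refine ⟨fun {A B} hA hB => ?_⟩
  obtain ⟨h₁, hh₁, h₂, hh₂, hu⟩ := UniqueProds.uniqueMul_of_nonempty (hA.image f) (hB.image f)
  obtain ⟨a, ha, rfl⟩ := Finset.mem_image.1 hh₁
  obtain ⟨b, hb, rfl⟩ := Finset.mem_image.1 hh₂
  set A' : Finset f.ker := {x ∈ A | f x = f a}.preimage (fun k : f.ker => a * k)
    (fun x _ y _ hxy => Subtype.ext (mul_left_cancel hxy)) with hA'
  set B' : Finset f.ker := {x ∈ B | f x = f b}.preimage (fun k : f.ker => (k : G) * b)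
    (fun x _ y _ hxy => Subtype.ext (mul_right_cancel hxy)) with hB'
  have h1A : (1 : f.ker) ∈ A' := Finset.mem_preimage.2 (by simp [ha])
  have h1B : (1 : f.ker) ∈ B' := Finset.mem_preimage.2 (by simp [hb])
  obtain ⟨k₁, hk₁, k₂, hk₂, hk⟩ := UniqueProds.uniqueMul_of_nonempty ⟨1, h1A⟩ ⟨1, h1B⟩
  have e₁ : f (a * k₁) = f a := by simp [(MonoidHom.mem_ker).1 k₁.2]
  have e₂ : f (k₂ * b) = f b := by simp [(MonoidHom.mem_ker).1 k₂.2]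
  refine ⟨a * k₁, ?_, k₂ * b, ?_,
    UniqueMul.of_image_filter (f : G →ₙ* H) e₁ e₂ hu ?_⟩
  · have := Finset.mem_preimage.1 hk₁
    exact (Finset.mem_filter.1 this).1
  · have := Finset.mem_preimage.1 hk₂
    exact (Finset.mem_filter.1 this).1
  · intro x y hx hy hxy
    obtain ⟨hxA, hfx⟩ := Finset.mem_filter.1 hx
    obtain ⟨hyB, hfy⟩ := Finset.mem_filter.1 hy
    have hfx' : f x = f a := hfx
    have hfy' : f y = f b := hfy
    have m₁ : a⁻¹ * x ∈ f.ker := by simp [MonoidHom.mem_ker, hfx']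
    have m₂ : y * b⁻¹ ∈ f.ker := by simp [MonoidHom.mem_ker, hfy']
    have := @hk ⟨a⁻¹ * x, m₁⟩ ⟨y * b⁻¹, m₂⟩
      (Finset.mem_preimage.2 (by simpa [hxA] using hfx'))
      (Finset.mem_preimage.2 (by simpa [hyB] using hfy'))
      (Subtype.ext (by
        show a⁻¹ * x * (y * b⁻¹) = k₁ * k₂
        have : x * y = a * k₁ * (k₂ * b) := hxy
        calc a⁻¹ * x * (y * b⁻¹) = a⁻¹ * (x * y) * b⁻¹ := by group
          _ = k₁ * k₂ := by rw [this]; group))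
    have q₁ : a⁻¹ * x = k₁ := congrArg Subtype.val this.1
    have q₂ : y * b⁻¹ = k₂ := congrArg Subtype.val this.2
    exact ⟨by rw [← q₁]; group, by rw [← q₂]; group⟩

theorem UniqueProds.of_comm_of_torsionFree {K : Type*} [Group K] (hc : ∀ a b : K, a * b = b * a)
    (ht : ∀ (a : K) (n : ℕ), 1 ≤ n → a ^ n = 1 → a = 1) : UniqueProds K := by
  classical
  refine ⟨fun {A B} hA hB => ?_⟩
  let L : Subgroup K := Subgroup.closure ((A ∪ B : Finset K) : Set K)
  let : CommGroup K := { ‹Group K› with mul_comm := hc }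
  have : Group.FG L := (Group.fg_iff_subgroup_fg L).2 ⟨A ∪ B, rfl⟩
  have : Monoid.FG L := Group.fg_iff_monoid_fg.1 inferInstance
  have : IsMulTorsionFree L := by
    refine ⟨fun n hn x y hxy => ?_⟩
    have h1 : ((x * y⁻¹ : L) : K) ^ n = 1 := by
      have : (x : K) ^ n = (y : K) ^ n := congrArg Subtype.val hxy
      rw [Subgroup.coe_mul, mul_pow, this, Subgroup.coe_inv, inv_pow, mul_inv_cancel]
    have h2 := ht _ n (Nat.one_le_iff_ne_zero.2 hn) h1
    exact mul_inv_eq_one.1 (Subtype.ext h2)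
  have hAL : ∀ x ∈ A, x ∈ L := fun x hx =>
    Subgroup.subset_closure (Finset.mem_coe.2 (Finset.mem_union_left _ hx))
  have hBL : ∀ x ∈ B, x ∈ L := fun x hx =>
    Subgroup.subset_closure (Finset.mem_coe.2 (Finset.mem_union_right _ hx))
  obtain ⟨a, ha⟩ := hA
  obtain ⟨b, hb⟩ := hB
  obtain ⟨x, hx, y, hy, hu⟩ := UniqueProds.uniqueMul_of_nonempty
    (A := A.subtype (· ∈ L)) (B := B.subtype (· ∈ L))
    ⟨⟨a, hAL a ha⟩, by simpa using ha⟩ ⟨⟨b, hBL b hb⟩, by simpa using hb⟩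
  refine ⟨x, by simpa using hx, y, by simpa using hy, fun p q hp hq hpq => ?_⟩
  have := @hu ⟨p, hAL p hp⟩ ⟨q, hBL q hq⟩ (by simpa using hp) (by simpa using hq)
    (Subtype.ext hpq)
  exact ⟨congrArg Subtype.val this.1, congrArg Subtype.val this.2⟩

theorem mem_ratDerived_succ {G : Type*} [Group G] {i : ℕ} {g : G} :
    g ∈ ratDerived G (i + 1) ↔ g ∈ ratDerived G i ∧
      ∃ k : ℕ, 1 ≤ k ∧ g ^ k ∈ ⁅ratDerived G i, ratDerived G i⁆ := by
  refine ⟨fun h => ?_, fun h => Subgroup.subset_closure h⟩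
  have hcm : ∀ a ∈ ratDerived G i, ∀ b ∈ ratDerived G i,
      Commute (a : G ⧸ ⁅ratDerived G i, ratDerived G i⁆) b := by
    intro a ha b hb
    rw [← commutatorElement_eq_one_iff_commute]
    exact (QuotientGroup.eq_one_iff (N := ⁅ratDerived G i, ratDerived G i⁆) ⁅a, b⁆).2
      (Subgroup.commutator_mem_commutator ha hb)
  change g ∈ Subgroup.closure _ at h
  induction h using Subgroup.closure_induction with
  | mem x hx => exact hx
  | one => exact ⟨one_mem _, 1, le_rfl, by simp⟩
  | mul x y _ _ hx hy =>
    obtain ⟨hx, k, hk, hxk⟩ := hx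
    obtain ⟨hy, l, hl, hyl⟩ := hy
    refine ⟨mul_mem hx hy, k * l, Nat.mul_pos hk hl, ?_⟩
    rw [← QuotientGroup.eq_one_iff] at hxk hyl ⊢
    have := hcm x hx y hy
    rw [QuotientGroup.mk_pow] at hxk hyl ⊢
    rw [QuotientGroup.mk_mul, this.mul_pow, pow_mul, hxk, mul_comm k l, pow_mul, hyl]
    simp
  | inv x _ hx =>
    obtain ⟨hx, k, hk, hxk⟩ := hx
    exact ⟨inv_mem hx, k, hk, by rw [inv_pow]; exact inv_mem hxk⟩

theorem ratDerived_antitone (G : Type*) [Group G] : Antitone (ratDerived G) :=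
  antitone_nat_of_succ_le fun _ _ h => (mem_ratDerived_succ.1 h).1

theorem commutator_ratDerived_le (G : Type*) [Group G] (i : ℕ) :
    ⁅ratDerived G i, ratDerived G i⁆ ≤ ratDerived G (i + 1) := fun x hx =>
  mem_ratDerived_succ.2 ⟨Subgroup.commutator_le_right _ _ hx, 1, le_rfl, by simpa using hx⟩

theorem mem_ratDerived_of_pow_mem {G : Type*} [Group G] {i : ℕ} {g : G} {n : ℕ} (hn : 1 ≤ n)
    (h : g ^ n ∈ ratDerived G i) : g ∈ ratDerived G i := by
  induction i with
  | zero => exact Subgroup.mem_top g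
  | succ i ih =>
    obtain ⟨h1, k, hk, h2⟩ := mem_ratDerived_succ.1 h
    exact mem_ratDerived_succ.2 ⟨ih h1, n * k, Nat.mul_pos hn hk, by rwa [pow_mul]⟩

instance uniqueProds_quotient_ratDerived (G : Type*) [Group G] (i : ℕ) :
    UniqueProds (G ⧸ ratDerived G i) := by
  induction i with
  | zero =>
    have : Subsingleton (G ⧸ ratDerived G 0) := QuotientGroup.subsingleton_quotient_top
    exact ⟨fun {A B} ⟨a, ha⟩ ⟨b, hb⟩ => ⟨a, ha, b, hb, UniqueMul.of_subsingleton⟩⟩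
  | succ i ih =>
    let f : G ⧸ ratDerived G (i + 1) →* G ⧸ ratDerived G i :=
      QuotientGroup.map _ _ (MonoidHom.id G) (ratDerived_antitone G i.le_succ)
    have hf : ∀ g : G, (g : G ⧸ ratDerived G (i + 1)) ∈ f.ker → g ∈ ratDerived G i :=
      fun g hg => (QuotientGroup.eq_one_iff g).1 hg
    have : UniqueProds f.ker := by
      refine UniqueProds.of_comm_of_torsionFree ?_ ?_
      · rintro ⟨a, ha⟩ ⟨b, hb⟩
        induction a using QuotientGroup.induction_on with | H a
        induction b using QuotientGroup.induction_on with | H b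
        apply Subtype.ext
        change (a * b : G ⧸ ratDerived G (i + 1)) = b * a
        rw [← commute_iff_eq, ← commutatorElement_eq_one_iff_commute]
        exact (QuotientGroup.eq_one_iff (N := ratDerived G (i + 1)) ⁅a, b⁆).2
          (commutator_ratDerived_le G i
            (Subgroup.commutator_mem_commutator (hf a ha) (hf b hb)))
      · rintro ⟨a, ha⟩ n hn h
        induction a using QuotientGroup.induction_on with | H a
        apply Subtype.ext
        have h' : ((a ^ n : G) : G ⧸ ratDerived G (i + 1)) = 1 := congrArg Subtype.val h
        exact (QuotientGroup.eq_one_iff a).2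
          (mem_ratDerived_of_pow_mem hn ((QuotientGroup.eq_one_iff _).1 h'))
    exact UniqueProds.of_ker f

namespace FoxCalculus

section Fox

variable {S Q : Type*} [Group Q] (π : FreeGroup S →* Q)

/-- The affine permutation `m ↦ s • m + eₛ` of the free module on `S` over the group ring. -/
noncomputable def foxPerm (s : S) : Equiv.Perm (S →₀ MonoidAlgebra ℤ Q) where
  toFun m := MonoidAlgebra.of ℤ Q (π (FreeGroup.of s)) • m + Finsupp.single s 1
  invFun m := MonoidAlgebra.of ℤ Q (π (FreeGroup.of s))⁻¹ • (m - Finsupp.single s 1)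
  left_inv m := by
    dsimp only
    rw [add_sub_cancel_right, smul_smul, ← map_mul, inv_mul_cancel, map_one, one_smul]
  right_inv m := by
    dsimp only
    rw [smul_smul, ← map_mul, mul_inv_cancel, map_one, one_smul, sub_add_cancel]

/-- The Fox derivatives of `u` with coefficients in the group ring of a quotient. -/
noncomputable def fox (u : FreeGroup S) : S →₀ MonoidAlgebra ℤ Q :=
  FreeGroup.lift (foxPerm π) u 0

theorem lift_foxPerm (u : FreeGroup S) (m : S →₀ MonoidAlgebra ℤ Q) :
    FreeGroup.lift (foxPerm π) u m = MonoidAlgebra.of ℤ Q (π u) • m + fox π u := by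
  unfold fox
  induction u using FreeGroup.induction_on generalizing m with
  | C1 => simp [← MonoidAlgebra.one_def]
  | of s => simp [foxPerm]
  | inv_of s _ =>
    rw [map_inv, FreeGroup.lift_apply_of, map_inv]
    change MonoidAlgebra.of ℤ Q (π (FreeGroup.of s))⁻¹ • (m - Finsupp.single s 1) =
      _ + MonoidAlgebra.of ℤ Q (π (FreeGroup.of s))⁻¹ • (0 - Finsupp.single s 1)
    rw [← smul_add, zero_sub, sub_eq_add_neg]
  | mul x y hx hy =>
    rw [map_mul, Equiv.Perm.mul_apply, Equiv.Perm.mul_apply, hy, hx, hx (FreeGroup.lift (foxPerm π) y 0),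
      map_mul, map_mul, smul_add, mul_smul, add_assoc]

@[simp] theorem fox_one : fox π 1 = 0 := by simp [fox]

@[simp] theorem fox_of (s : S) : fox π (FreeGroup.of s) = Finsupp.single s 1 := by
  simp [fox, foxPerm]

theorem fox_mul (u v : FreeGroup S) :
    fox π (u * v) = fox π u + MonoidAlgebra.of ℤ Q (π u) • fox π v := by
  rw [fox, map_mul, Equiv.Perm.mul_apply, lift_foxPerm, add_comm, fox, fox]

theorem fox_inv (u : FreeGroup S) :
    fox π u⁻¹ = -(MonoidAlgebra.of ℤ Q (π u)⁻¹ • fox π u) := by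
  have h := fox_mul π u⁻¹ u
  rw [inv_mul_cancel, fox_one, map_inv] at h
  exact eq_neg_of_add_eq_zero_left h.symm

theorem fox_mul_of_map_eq_one {u : FreeGroup S} (hu : π u = 1) (v : FreeGroup S) :
    fox π (u * v) = fox π u + fox π v := by
  rw [fox_mul, hu, map_one, one_smul]

theorem fox_inv_of_map_eq_one {u : FreeGroup S} (hu : π u = 1) : fox π u⁻¹ = -fox π u := by
  rw [fox_inv, hu, inv_one, map_one, one_smul]

theorem fox_pow_of_map_eq_one {u : FreeGroup S} (hu : π u = 1) (n : ℕ) :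
    fox π (u ^ n) = n • fox π u := by
  induction n with
  | zero => simp
  | succ n ih => rw [pow_succ', fox_mul_of_map_eq_one π hu, ih, succ_nsmul']

theorem fox_zpow_of_map_eq_one {u : FreeGroup S} (hu : π u = 1) (n : ℤ) :
    fox π (u ^ n) = n • fox π u := by
  cases n with
  | ofNat n => simpa using fox_pow_of_map_eq_one π hu n
  | negSucc n =>
    rw [zpow_negSucc, fox_inv_of_map_eq_one π (by simp [hu]), fox_pow_of_map_eq_one π hu,
      negSucc_zsmul]

theorem fox_conj {u : FreeGroup S} (hu : π u = 1) (g : FreeGroup S) :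
    fox π (g * u * g⁻¹) = MonoidAlgebra.of ℤ Q (π g) • fox π u := by
  rw [fox_mul, fox_mul, map_mul, hu, mul_one, fox_inv, smul_neg, smul_smul, ← map_mul,
    mul_inv_cancel, map_one, one_smul, add_assoc, add_comm, add_assoc, neg_add_cancel, add_zero]

/-- The elements of the kernel of `π` with vanishing Fox derivatives. -/
def foxKer : Subgroup (FreeGroup S) where
  carrier := {u | π u = 1 ∧ fox π u = 0}
  one_mem' := by simp
  mul_mem' {u v} hu hv := by
    refine ⟨by rw [map_mul, hu.1, hv.1, one_mul], ?_⟩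
    rw [fox_mul_of_map_eq_one π hu.1, hu.2, hv.2, add_zero]
  inv_mem' {u} hu := by
    refine ⟨by rw [map_inv, hu.1, inv_one], ?_⟩
    rw [fox_inv_of_map_eq_one π hu.1, hu.2, neg_zero]

theorem commutator_ker_le_foxKer : ⁅π.ker, π.ker⁆ ≤ foxKer π := by
  rw [Subgroup.commutator_le]
  intro u hu v hv
  rw [MonoidHom.mem_ker] at hu hv
  refine ⟨by simp [commutatorElement_def, hu, hv], ?_⟩
  rw [commutatorElement_def, fox_mul_of_map_eq_one π (by simp [hu, hv]),
    fox_mul_of_map_eq_one π (by simp [hu, hv]), fox_mul_of_map_eq_one π hu,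
    fox_inv_of_map_eq_one π hu, fox_inv_of_map_eq_one π hv]
  abel

theorem fox_eq_zero_of_mem_commutator {u : FreeGroup S} (hu : u ∈ ⁅π.ker, π.ker⁆) :
    fox π u = 0 := (commutator_ker_le_foxKer π hu).2

theorem fox_mem_of_mem_normalClosure {w r : FreeGroup S} (hw : π w = 1)
    (hr : r ∈ Subgroup.normalClosure {w}) :
    π r = 1 ∧ ∃ a : MonoidAlgebra ℤ Q, fox π r = a • fox π w := by
  change r ∈ Subgroup.closure _ at hr
  induction hr using Subgroup.closure_induction with
  | mem x hx =>
    obtain ⟨y, rfl, hy⟩ := Group.mem_conjugatesOfSet_iff.1 hx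
    obtain ⟨g, rfl⟩ := isConj_iff.1 hy
    exact ⟨by simp [hw], _, fox_conj π hw g⟩
  | one => exact ⟨map_one π, 0, by simp⟩
  | mul x y _ _ hx hy =>
    obtain ⟨hx, a, ha⟩ := hx
    obtain ⟨hy, b, hb⟩ := hy
    exact ⟨by simp [hx, hy], a + b, by rw [fox_mul_of_map_eq_one π hx, ha, hb, add_smul]⟩
  | inv x _ hx =>
    obtain ⟨hx, a, ha⟩ := hx
    exact ⟨by simp [hx], -a, by rw [fox_inv_of_map_eq_one π hx, ha, neg_smul]⟩

theorem exists_mem_normalClosure_fox_eq {w : FreeGroup S} (hπ : Function.Surjective π)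
    (hw : π w = 1) (a : MonoidAlgebra ℤ Q) :
    ∃ r ∈ Subgroup.normalClosure {w}, fox π r = a • fox π w := by
  have hw' : w ∈ Subgroup.normalClosure {w} := Subgroup.subset_normalClosure rfl
  induction a using MonoidAlgebra.induction_linear with
  | zero => exact ⟨1, one_mem _, by simp⟩
  | add a b ha hb =>
    obtain ⟨r, hr, ha⟩ := ha
    obtain ⟨t, ht, hb⟩ := hb
    refine ⟨r * t, mul_mem hr ht, ?_⟩
    rw [fox_mul_of_map_eq_one π (fox_mem_of_mem_normalClosure π hw hr).1, ha, hb, add_smul]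
  | single q n =>
    obtain ⟨g, rfl⟩ := hπ q
    refine ⟨g * w ^ n * g⁻¹, Subgroup.normalClosure_normal.conj_mem _ (zpow_mem hw' n) g, ?_⟩
    rw [fox_conj π (by simp [hw]), fox_zpow_of_map_eq_one π hw, smul_comm, ← smul_assoc]
    congr 1
    rw [MonoidAlgebra.of_apply, MonoidAlgebra.smul_single, smul_eq_mul, mul_one]

theorem fox_comp_apply {R : Type*} [Group R] (h : Q →* R) (u : FreeGroup S) (s : S) :
    fox (h.comp π) u s = MonoidAlgebra.mapDomainRingHom ℤ h (fox π u s) := by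
  classical
  induction u using FreeGroup.induction_on with
  | C1 => simp
  | of t =>
    rw [fox_of, fox_of, Finsupp.single_apply, Finsupp.single_apply]
    split_ifs <;> simp
  | inv_of t ht =>
    rw [fox_inv, fox_inv, Finsupp.neg_apply, Finsupp.neg_apply, Finsupp.smul_apply,
      Finsupp.smul_apply, ht, smul_eq_mul, smul_eq_mul, map_neg, map_mul]
    simp
  | mul x y hx hy =>
    rw [fox_mul, fox_mul, Finsupp.add_apply, Finsupp.add_apply, Finsupp.smul_apply,
      Finsupp.smul_apply, hx, hy, smul_eq_mul, smul_eq_mul, map_add, map_mul]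
    simp

/-- **Magnus embedding**: an element of the kernel of `π` all of whose Fox derivatives vanish
is a product of commutators of elements of the kernel. -/
theorem mem_commutator_ker_of_fox_eq_zero (hπ : Function.Surjective π) {u : FreeGroup S}
    (hu : π u = 1) (h : fox π u = 0) : u ∈ ⁅π.ker, π.ker⁆ := by
  choose σ hσ using hπ
  let E : Q → FreeGroup S → π.ker := fun q v => ⟨σ q * v * (σ (q * π v))⁻¹, by
    simp [MonoidHom.mem_ker, hσ]⟩
  have hE : ∀ q v v', E q (v * v') = E q v * E (q * π v) v' := fun q v v' => by
    apply Subtype.ext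
    simp only [E, Subgroup.coe_mul, map_mul]
    rw [mul_assoc q]
    group
  let e : Q → FreeGroup S → Additive (Abelianization π.ker) :=
    fun q v => Additive.ofMul (Abelianization.of (E q v))
  have he : ∀ q v v', e q (v * v') = e q v + e (q * π v) v' := fun q v v' => by
    simp only [e, hE, map_mul, ofMul_mul]
  have he1 : ∀ q, e q 1 = 0 := fun q => by simpa using he q 1 1
  have heinv : ∀ q v, e q v⁻¹ = -e (q * (π v)⁻¹) v := fun q v => by
    have := he q v⁻¹ v
    rw [inv_mul_cancel, he1, map_inv] at this
    exact eq_neg_of_add_eq_zero_left this.symm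
  let θ : (S →₀ MonoidAlgebra ℤ Q) →+ Additive (Abelianization π.ker) :=
    Finsupp.liftAddHom fun s =>
      (Finsupp.liftAddHom fun q => zmultiplesHom _ (e q (FreeGroup.of s))).comp
        (MonoidAlgebra.coeffAddEquiv (R := ℤ) (M := Q)).toAddMonoidHom
  have hθ1 : ∀ q s, θ (MonoidAlgebra.of ℤ Q q • Finsupp.single s 1) = e q (FreeGroup.of s) := by
    intro q s
    rw [Finsupp.smul_single, smul_eq_mul, mul_one]
    simp [θ, MonoidAlgebra.coeffAddEquiv]
  have hθ : ∀ v q, θ (MonoidAlgebra.of ℤ Q q • fox π v) = e q v := by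
    intro v
    induction v using FreeGroup.induction_on with
    | C1 => intro q; rw [fox_one, smul_zero, map_zero, he1]
    | of s => intro q; rw [fox_of, hθ1]
    | inv_of s hs =>
      intro q
      rw [fox_inv, smul_neg, map_neg, smul_smul, ← map_mul, hs, heinv]
    | mul x y hx hy =>
      intro q
      rw [fox_mul, smul_add, map_add, smul_smul, ← map_mul, hx, hy, he]
  have h1 : Abelianization.of (E 1 u) = 1 := by
    have := hθ u 1
    rw [h, smul_zero, map_zero] at this
    exact Additive.ofMul.injective this.symm
  have h2 : E 1 u ∈ commutator π.ker := by
    rw [← Abelianization.ker_of]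
    exact h1
  have h3 : σ 1 * u * (σ 1)⁻¹ ∈ ⁅π.ker, π.ker⁆ := by
    rw [← Subgroup.map_subtype_commutator]
    exact ⟨_, h2, by simp [E, hu]⟩
  have h4 := (inferInstance : (⁅π.ker, π.ker⁆).Normal).conj_mem _ h3 (σ 1)⁻¹
  simpa [mul_assoc] using h4

end Fox

section Quotients

variable {S G : Type*} [Group G] (p : FreeGroup S →* G)

/-- The composite of a homomorphism with the projection modulo a normal subgroup. -/
def toQuot (N : Subgroup G) [N.Normal] : FreeGroup S →* G ⧸ N := (QuotientGroup.mk' N).comp p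

theorem toQuot_eq_one {N : Subgroup G} [N.Normal] {u : FreeGroup S} :
    toQuot p N u = 1 ↔ p u ∈ N := QuotientGroup.eq_one_iff (p u)

theorem ker_toQuot (N : Subgroup G) [N.Normal] : (toQuot p N).ker = N.comap p :=
  Subgroup.ext fun _ => toQuot_eq_one p

theorem toQuot_surjective (hp : Function.Surjective p) (N : Subgroup G) [N.Normal] :
    Function.Surjective (toQuot p N) := (QuotientGroup.mk'_surjective N).comp hp

variable (G) in
/-- The projection of the quotient by `D^ω` onto the quotient by `D^i`. -/
def omegaProj (i : ℕ) : G ⧸ ratDerivedOmega G →* G ⧸ ratDerived G i :=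
  QuotientGroup.map _ _ (MonoidHom.id G) (iInf_le _ i)

theorem omegaProj_comp_toQuot (i : ℕ) :
    (omegaProj G i).comp (toQuot p (ratDerivedOmega G)) = toQuot p (ratDerived G i) := rfl

variable (G) in
/-- The projection of the quotient by `D^j` onto the quotient by `D^i`, for `i ≤ j`. -/
def ratDerivedProj {i j : ℕ} (h : i ≤ j) : G ⧸ ratDerived G j →* G ⧸ ratDerived G i :=
  QuotientGroup.map _ _ (MonoidHom.id G) (ratDerived_antitone G h)

theorem ratDerivedProj_comp_toQuot {i j : ℕ} (h : i ≤ j) :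
    (ratDerivedProj G h).comp (toQuot p (ratDerived G j)) = toQuot p (ratDerived G i) := rfl

theorem ratDerivedProj_omegaProj {i j : ℕ} (h : i ≤ j) (x : G ⧸ ratDerivedOmega G) :
    ratDerivedProj G h (omegaProj G j x) = omegaProj G i x := by
  induction x using QuotientGroup.induction_on with | H x
  rfl

theorem exists_forall_omegaProj_eq_imp (x y : G ⧸ ratDerivedOmega G) :
    ∃ i, ∀ j, i ≤ j → omegaProj G j x = omegaProj G j y → x = y := by
  by_cases h : ∀ j, omegaProj G j x = omegaProj G j y
  · refine ⟨0, fun _ _ _ => ?_⟩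
    induction x using QuotientGroup.induction_on with | H x
    induction y using QuotientGroup.induction_on with | H y
    exact QuotientGroup.eq.2 (Subgroup.mem_iInf.2 fun j => QuotientGroup.eq.1 (h j))
  · push Not at h
    obtain ⟨i, hi⟩ := h
    refine ⟨i, fun j hij hj => absurd ?_ hi⟩
    rw [← ratDerivedProj_omegaProj hij, hj, ratDerivedProj_omegaProj hij]

theorem exists_injOn_omegaProj (T : Finset (G ⧸ ratDerivedOmega G)) :
    ∃ i, ∀ j, i ≤ j → Set.InjOn (omegaProj G j) T := by
  choose J hJ using exists_forall_omegaProj_eq_imp (G := G)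
  refine ⟨(T ×ˢ T).sup fun x => J x.1 x.2, fun j hj x hx y hy hxy => hJ x y j (le_trans ?_ hj) hxy⟩
  exact Finset.le_sup (f := fun x : (G ⧸ ratDerivedOmega G) × (G ⧸ ratDerivedOmega G) =>
    J x.1 x.2) (Finset.mk_mem_product hx hy)

theorem exists_forall_mapDomain_ne_zero {x : MonoidAlgebra ℤ (G ⧸ ratDerivedOmega G)}
    (hx : x ≠ 0) :
    ∃ i, ∀ j, i ≤ j → MonoidAlgebra.mapDomainRingHom ℤ (omegaProj G j) x ≠ 0 := by
  obtain ⟨i, hi⟩ := exists_injOn_omegaProj x.coeff.support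
  refine ⟨i, fun j hj h0 => hx ?_⟩
  rw [← MonoidAlgebra.coeff_eq_zero]
  ext a
  by_cases ha : a ∈ x.coeff.support
  · have h1 := Finsupp.mapDomain_apply' (x.coeff.support : Set _) x.coeff subset_rfl (hi j hj) ha
    rw [← h1]
    have h2 : Finsupp.mapDomain (omegaProj G j) x.coeff = 0 :=
      congrArg MonoidAlgebra.coeff h0
    rw [h2]
    rfl
  · exact Finsupp.notMem_support_iff.1 ha

instance noZeroDivisors_omega :
    NoZeroDivisors (MonoidAlgebra ℤ (G ⧸ ratDerivedOmega G)) := by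
  refine ⟨fun {x y} h => ?_⟩
  by_contra! hxy
  obtain ⟨i, hi⟩ := exists_forall_mapDomain_ne_zero hxy.1
  obtain ⟨j, hj⟩ := exists_forall_mapDomain_ne_zero hxy.2
  refine mul_ne_zero (hi (max i j) (le_max_left i j)) (hj (max i j) (le_max_right i j)) ?_
  rw [← map_mul, h, map_zero]

theorem fox_omega_eq_zero {u : FreeGroup S}
    (h : ∀ j, fox (toQuot p (ratDerived G j)) u = 0) :
    fox (toQuot p (ratDerivedOmega G)) u = 0 := by
  ext1 s
  by_contra hne
  obtain ⟨i, hi⟩ := exists_forall_mapDomain_ne_zero hne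
  refine hi i le_rfl ?_
  rw [← fox_comp_apply, omegaProj_comp_toQuot, h]
  rfl

theorem fox_ne_zero_of_le {i j : ℕ} (hij : i ≤ j) {u : FreeGroup S}
    (h : fox (toQuot p (ratDerived G i)) u ≠ 0) : fox (toQuot p (ratDerived G j)) u ≠ 0 := by
  refine fun h0 => h ?_
  ext1 s
  rw [← ratDerivedProj_comp_toQuot p hij, fox_comp_apply, h0]
  simp

theorem exists_pow_eq_mul_of_mem_ratDerived_succ (hp : Function.Surjective p) {i : ℕ}
    {u : FreeGroup S} (hu : p u ∈ ratDerived G (i + 1)) :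
    ∃ k : ℕ, 1 ≤ k ∧ ∃ x ∈ ⁅(ratDerived G i).comap p, (ratDerived G i).comap p⁆,
      ∃ r ∈ p.ker, u ^ k = x * r := by
  obtain ⟨_, k, hk, hm⟩ := mem_ratDerived_succ.1 hu
  rw [← Subgroup.map_comap_eq_self_of_surjective hp (ratDerived G i),
    ← Subgroup.map_commutator] at hm
  obtain ⟨x, hx, hxk⟩ := hm
  refine ⟨k, hk, x, hx, x⁻¹ * u ^ k, ?_, by group⟩
  rw [MonoidHom.mem_ker, map_mul, map_inv, hxk, map_pow, inv_mul_cancel]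

theorem exists_nsmul_fox_eq_smul (hp : Function.Surjective p) {w : FreeGroup S}
    (hw : p.ker = Subgroup.normalClosure {w}) {i : ℕ} {u : FreeGroup S}
    (hu : p u ∈ ratDerived G (i + 1)) :
    ∃ k : ℕ, 1 ≤ k ∧ ∃ a : MonoidAlgebra ℤ (G ⧸ ratDerived G i),
      k • fox (toQuot p (ratDerived G i)) u = a • fox (toQuot p (ratDerived G i)) w := by
  obtain ⟨k, hk, x, hx, r, hr, h⟩ := exists_pow_eq_mul_of_mem_ratDerived_succ p hp hu
  have hw1 : toQuot p (ratDerived G i) w = 1 := by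
    have : w ∈ p.ker := hw ▸ Subgroup.subset_normalClosure rfl
    rw [toQuot_eq_one, (MonoidHom.mem_ker).1 this]
    exact one_mem _
  rw [hw] at hr
  obtain ⟨_, a, ha⟩ := fox_mem_of_mem_normalClosure _ hw1 hr
  rw [← ker_toQuot] at hx
  refine ⟨k, hk, a, ?_⟩
  rw [← fox_pow_of_map_eq_one, h, fox_mul_of_map_eq_one _ ((MonoidHom.mem_ker).1
    (Subgroup.commutator_le_right _ _ hx)), fox_eq_zero_of_mem_commutator _ hx, ha, zero_add]
  exact (toQuot_eq_one p).2 (mem_ratDerived_succ.1 hu).1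

end Quotients

theorem eq_bot_of_le_commutator {S : Type*} (H : Subgroup (FreeGroup S)) (h : H ≤ ⁅H, H⁆) :
    H = ⊥ := by
  have hc : commutator H = ⊤ := by
    refine eq_top_iff.2 fun x _ => ?_
    have := h x.2
    rw [← Subgroup.map_subtype_commutator] at this
    obtain ⟨y, hy, hyx⟩ := this
    rwa [← Subtype.ext (a1 := y) (a2 := x) hyx]
  have hE : IsEmpty (IsFreeGroup.Generators H) := by
    refine ⟨fun a => ?_⟩
    let f : H →* Multiplicative ℤ := IsFreeGroup.lift fun _ => Multiplicative.ofAdd 1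
    have h1 : IsFreeGroup.of a ∈ f.ker :=
      Abelianization.commutator_subset_ker f (hc ▸ Subgroup.mem_top _)
    have h2 : f (IsFreeGroup.of a) = Multiplicative.ofAdd 1 := IsFreeGroup.lift_of _ a
    rw [MonoidHom.mem_ker, h2] at h1
    exact one_ne_zero (Multiplicative.ofAdd.injective h1)
  have : Subsingleton H := (IsFreeGroup.toFreeGroup H).toEquiv.subsingleton
  exact (Subgroup.eq_bot_iff_forall H).2 fun x hx =>
    congrArg Subtype.val (Subsingleton.elim (⟨x, hx⟩ : H) 1)

theorem ratDerivedOmega_freeGroup (S : Type*) : ratDerivedOmega (FreeGroup S) = ⊥ := by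
  refine eq_bot_of_le_commutator _ fun u hu => ?_
  let q := MonoidHom.id (FreeGroup S)
  have hq : q.ker = Subgroup.normalClosure {1} := by
    refine le_antisymm (fun x hx => ?_)
      (Subgroup.normalClosure_le_normal (Set.singleton_subset_iff.2 (one_mem _)))
    rw [show x = 1 from hx]
    exact one_mem _
  have h0 : fox (toQuot q (ratDerivedOmega (FreeGroup S))) u = 0 := by
    refine fox_omega_eq_zero q fun j => ?_
    obtain ⟨k, hk, a, ha⟩ := exists_nsmul_fox_eq_smul q Function.surjective_id hq
      (u := u) (i := j) (Subgroup.mem_iInf.1 hu (j + 1))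
    rw [fox_one, smul_zero] at ha
    exact (smul_eq_zero.1 ha).resolve_left (by omega)
  have := mem_commutator_ker_of_fox_eq_zero _ (toQuot_surjective q Function.surjective_id _)
    ((toQuot_eq_one q).2 hu) h0
  rwa [ker_toQuot] at this

section OneRelator

variable {S G : Type*} [Group G] (p : FreeGroup S →* G)

theorem toQuot_relator_eq_one {w : FreeGroup S}
    (hw : p.ker = Subgroup.normalClosure {w}) (N : Subgroup G) [N.Normal] : toQuot p N w = 1 := by
  have : w ∈ p.ker := hw ▸ Subgroup.subset_normalClosure rfl
  rw [toQuot_eq_one, (MonoidHom.mem_ker).1 this]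
  exact one_mem _

theorem exists_forall_fox_relator_ne_zero (hp : Function.Surjective p) {w : FreeGroup S}
    (hw : p.ker = Subgroup.normalClosure {w}) (hne : ratDerivedOmega G ≠ ⊥) :
    ∃ i, ∀ j, i ≤ j → fox (toQuot p (ratDerived G j)) w ≠ 0 := by
  by_contra! h
  have h0 : ∀ j, fox (toQuot p (ratDerived G j)) w = 0 := fun j => by
    by_contra hj
    obtain ⟨k, hk, h0⟩ := h j
    exact fox_ne_zero_of_le p hk hj h0
  have hker : ∀ j, p.ker ≤ ⁅(ratDerived G j).comap p, (ratDerived G j).comap p⁆ := fun j => by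
    rw [hw]
    refine Subgroup.normalClosure_le_normal (Set.singleton_subset_iff.2 ?_)
    have := mem_commutator_ker_of_fox_eq_zero _ (toQuot_surjective p hp _)
      (toQuot_relator_eq_one p hw (ratDerived G j)) (h0 j)
    rwa [ker_toQuot] at this
  have hle : ∀ j, (ratDerived G j).comap p ≤ ratDerived (FreeGroup S) j := by
    intro j
    induction j with
    | zero => exact le_top
    | succ j ih =>
      intro u hu
      obtain ⟨k, hk, x, hx, r, hr, hxr⟩ := exists_pow_eq_mul_of_mem_ratDerived_succ p hp hu
      refine mem_ratDerived_succ.2 ⟨ih (mem_ratDerived_succ.1 hu).1, k, hk, ?_⟩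
      exact Subgroup.commutator_mono ih ih (hxr ▸ mul_mem hx (hker j hr))
  refine hne ((Subgroup.eq_bot_iff_forall _).2 fun v hv => ?_)
  obtain ⟨u, rfl⟩ := hp v
  have hu : u ∈ ratDerivedOmega (FreeGroup S) :=
    Subgroup.mem_iInf.2 fun j => hle j (Subgroup.mem_iInf.1 hv j)
  rw [ratDerivedOmega_freeGroup, Subgroup.mem_bot] at hu
  rw [hu, map_one]

theorem eq_one_of_eq_pow (hp : Function.Surjective p) {w : FreeGroup S}
    (hw : p.ker = Subgroup.normalClosure {w}) (hne : ratDerivedOmega G ≠ ⊥)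
    (htf : ∀ g : G, IsOfFinOrder g → g = 1) (c : FreeGroup S) (m : ℕ) (hc : w = c ^ m) :
    m = 1 := by
  obtain ⟨i, hi⟩ := exists_forall_fox_relator_ne_zero p hp hw hne
  have hD := hi i le_rfl
  set π := toQuot p (ratDerived G i) with hπ
  rcases Nat.eq_zero_or_pos m with rfl | hm
  · simp [hc] at hD
  have hpw : p w = 1 := by
    have : w ∈ p.ker := hw ▸ Subgroup.subset_normalClosure rfl
    exact this
  have hpc : p c = 1 := htf _ (isOfFinOrder_iff_pow_eq_one.2 ⟨m, hm, by rw [← map_pow, ← hc, hpw]⟩)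
  have hcw : c ∈ Subgroup.normalClosure {w} := hw ▸ (MonoidHom.mem_ker).2 hpc
  obtain ⟨hπc, a, ha⟩ := fox_mem_of_mem_normalClosure π (toQuot_relator_eq_one p hw _) hcw
  have hDw : fox π w = m • fox π c := by rw [hc, fox_pow_of_map_eq_one π hπc]
  have hc0 : fox π c ≠ 0 := fun h0 => hD (by rw [hDw, h0, smul_zero])
  obtain ⟨s, hs⟩ := Finsupp.ne_iff.1 hc0
  have h1 : (1 - m • a) * fox π c s = 0 := by
    have := DFunLike.congr_fun ha s
    rw [hDw, Finsupp.smul_apply, Finsupp.smul_apply, smul_eq_mul, mul_smul_comm] at this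
    rw [sub_mul, one_mul, smul_mul_assoc, ← this, sub_self]
  have h2 : 1 - m • a = 0 := (mul_eq_zero.1 h1).resolve_right hs
  have h3 := congrArg (MonoidAlgebra.lift ℤ ℤ (G ⧸ ratDerived G i) 1) h2
  rw [map_sub, map_one, map_nsmul, map_zero, nsmul_eq_mul, sub_eq_zero] at h3
  have := Int.isUnit_iff.1 (IsUnit.of_mul_eq_one _ h3.symm)
  omega

end OneRelator

open Polynomial in
theorem exists_monic_eval₂_smul_eq_zero {A X : Type*} [Ring A] [AddCommGroup X] [Module A X]
    (t : A) {W : Submodule ℤ X} (hW : W.FG) (ht : ∀ x ∈ W, t • x ∈ W) :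
    ∃ P : ℤ[X], P.Monic ∧ ∀ x ∈ W, P.eval₂ (Int.castRingHom A) t • x = 0 := by
  let φ : X →ₗ[ℤ] X := (DistribSMul.toAddMonoidHom X t).toIntLinearMap
  let ψ : Module.End ℤ W := φ.restrict ht
  have : Module.Finite ℤ W := Module.Finite.iff_fg.2 hW
  obtain ⟨P, hP, h0⟩ := LinearMap.exists_monic_and_aeval_eq_zero ℤ ψ
  have hpow : ∀ (n : ℕ) (x : W), ((ψ ^ n) x : X) = t ^ n • (x : X) := by
    intro n
    induction n with
    | zero => simp
    | succ n ih =>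
      intro x
      rw [pow_succ', Module.End.mul_apply, pow_succ', mul_smul, ← ih]
      rfl
  have key : ∀ (q : ℤ[X]) (x : W),
      ((aeval ψ q x : W) : X) = q.eval₂ (Int.castRingHom A) t • (x : X) := by
    intro q x
    induction q using Polynomial.induction_on' with
    | add p q hp hq => rw [map_add, eval₂_add, add_smul, ← hp, ← hq]; rfl
    | monomial n a =>
      rw [aeval_monomial, eval₂_monomial, mul_smul, ← hpow, eq_intCast (Int.castRingHom A),
        Int.cast_smul_eq_zsmul, Module.End.mul_apply, Module.algebraMap_end_apply]
      rfl
  refine ⟨P, hP, fun x hx => ?_⟩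
  have := key P ⟨x, hx⟩
  rw [h0] at this
  exact this.symm

open Polynomial in
theorem map_eval₂_intCast {A B : Type*} [Ring A] [Ring B] (f : A →+* B) (t : A) (P : ℤ[X]) :
    f (P.eval₂ (Int.castRingHom A) t) = P.eval₂ (Int.castRingHom B) (f t) := by
  rw [hom_eval₂, RingHom.ext_int (f.comp (Int.castRingHom A)) (Int.castRingHom B)]

open Polynomial in
theorem eval₂_of_ne_zero {Q : Type*} [Group Q] {t : Q} (ht : ∀ n : ℕ, 1 ≤ n → t ^ n ≠ 1)
    {P : ℤ[X]} (hP : P.Monic) :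
    P.eval₂ (Int.castRingHom (MonoidAlgebra ℤ Q)) (MonoidAlgebra.of ℤ Q t) ≠ 0 := by
  have hinj : Function.Injective fun n : ℕ => t ^ n :=
    injective_pow_iff_not_isOfFinOrder.2 fun h => by
      obtain ⟨n, hn, h1⟩ := isOfFinOrder_iff_pow_eq_one.1 h
      exact ht n hn h1
  have hmap : P.eval₂ (Int.castRingHom (MonoidAlgebra ℤ Q)) (MonoidAlgebra.of ℤ Q t) =
      ∑ i ∈ Finset.range (P.natDegree + 1), MonoidAlgebra.single (t ^ i) (P.coeff i) := by
    rw [eval₂_eq_sum_range]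
    refine Finset.sum_congr rfl fun i _ => ?_
    rw [← map_pow, MonoidAlgebra.of_apply, eq_intCast, ← zsmul_eq_mul,
      MonoidAlgebra.smul_single, smul_eq_mul, mul_one]
  intro h0
  have h1 := congrArg (fun x : MonoidAlgebra ℤ Q => x.coeff (t ^ P.natDegree)) h0
  classical
  simp only [hmap, MonoidAlgebra.coeff_sum, Finsupp.finsetSum_apply, MonoidAlgebra.coeff_zero,
    Finsupp.coe_zero, Pi.zero_apply, MonoidAlgebra.coeff_single, Finsupp.single_apply,
    hinj.eq_iff] at h1
  simp [hP.coeff_natDegree] at h1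

open Polynomial in
theorem map_eval₂_mul {A B : Type*} [Ring A] [Ring B] (σ : A →+ B) {s : A} {t : B}
    (h : ∀ x, σ (s * x) = t * σ x) (P : ℤ[X]) (x : A) :
    σ (P.eval₂ (Int.castRingHom A) s * x) = P.eval₂ (Int.castRingHom B) t * σ x := by
  have hpow : ∀ (n : ℕ) (x : A), σ (s ^ n * x) = t ^ n * σ x := by
    intro n
    induction n with
    | zero => simp
    | succ n ih => intro x; rw [pow_succ', mul_assoc, h, ih, pow_succ', mul_assoc]
  induction P using Polynomial.induction_on' with
  | add p q hp hq => rw [eval₂_add, eval₂_add, add_mul, add_mul, map_add, hp, hq]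
  | monomial n a =>
    rw [eval₂_monomial, eval₂_monomial, eq_intCast, eq_intCast, mul_assoc, mul_assoc,
      ← zsmul_eq_mul, ← zsmul_eq_mul, map_zsmul, hpow]

theorem exists_addMonoidHom_section {Q R : Type*} [Group Q] [Group R] (q : Q →* R) (t : Q)
    {Y : Set Q} (hY : ∀ y, t * y ∈ Y ↔ y ∈ Y) (hq : Set.InjOn q Y) :
    ∃ σ : MonoidAlgebra ℤ R →+ MonoidAlgebra ℤ Q,
      (∀ x, σ (MonoidAlgebra.of ℤ R (q t) * x) = MonoidAlgebra.of ℤ Q t * σ x) ∧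
      ∀ x : MonoidAlgebra ℤ Q, (x.coeff.support : Set Q) ⊆ Y →
        σ (MonoidAlgebra.mapDomainRingHom ℤ q x) = x := by
  classical
  let σ : MonoidAlgebra ℤ R →+ MonoidAlgebra ℤ Q :=
    (Finsupp.liftAddHom fun r : R => if h : ∃ y ∈ Y, q y = r then
      MonoidAlgebra.singleAddHom (R := ℤ) h.choose else 0).comp
        (MonoidAlgebra.coeffAddEquiv (R := ℤ) (M := R)).toAddMonoidHom
  have hσ : ∀ r n, σ (MonoidAlgebra.single r n) = (if h : ∃ y ∈ Y, q y = r then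
      MonoidAlgebra.singleAddHom (R := ℤ) h.choose else 0) n := fun r n => by
    simp [σ, MonoidAlgebra.coeffAddEquiv]
  have hσ1 : ∀ y ∈ Y, ∀ n, σ (MonoidAlgebra.single (q y) n) = MonoidAlgebra.single y n := by
    intro y hy n
    have h : ∃ z ∈ Y, q z = q y := ⟨y, hy, rfl⟩
    rw [hσ, dif_pos h, hq h.choose_spec.1 hy h.choose_spec.2]
    rfl
  have hσ2 : ∀ r n, (¬ ∃ y ∈ Y, q y = r) → σ (MonoidAlgebra.single r n) = 0 := by
    intro r n h
    rw [hσ, dif_neg h]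
    rfl
  refine ⟨σ, fun x => ?_, fun x hx => ?_⟩
  · induction x using MonoidAlgebra.induction_linear with
    | zero => simp
    | add x y hx hy => rw [mul_add, map_add, hx, hy, map_add, mul_add]
    | single r n =>
      rw [MonoidAlgebra.of_apply, MonoidAlgebra.single_mul_single, one_mul]
      by_cases h : ∃ y ∈ Y, q y = r
      · obtain ⟨y, hy, rfl⟩ := h
        rw [← map_mul, hσ1 _ ((hY y).2 hy), hσ1 y hy, MonoidAlgebra.of_apply,
          MonoidAlgebra.single_mul_single, one_mul]
      · rw [hσ2 r n h, hσ2 _ n, mul_zero]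
        rintro ⟨y, hy, hyr⟩
        refine h ⟨t⁻¹ * y, (hY _).1 (by rwa [mul_inv_cancel_left]), ?_⟩
        rw [map_mul, hyr, map_inv, inv_mul_cancel_left]
  · conv_lhs => rw [← MonoidAlgebra.sum_coeff_single x]
    conv_rhs => rw [← MonoidAlgebra.sum_coeff_single x]
    rw [Finsupp.sum, map_sum, map_sum]
    refine Finset.sum_congr rfl fun y hy => ?_
    conv_rhs => rw [← hσ1 y (hx hy)]
    congr 1
    simp

theorem exists_injOn_orbit {G : Type*} [Group G] {t : G ⧸ ratDerivedOmega G}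
    (ht : ∀ n : ℕ, 1 ≤ n → omegaProj G 1 t ^ n ≠ 1) (T : Finset (G ⧸ ratDerivedOmega G)) :
    ∃ i, ∀ j, i ≤ j → Set.InjOn (omegaProj G j) {y | ∃ n : ℤ, ∃ s ∈ T, t ^ n * s = y} := by
  have hz : Function.Injective fun n : ℤ => omegaProj G 1 t ^ n :=
    injective_zpow_iff_not_isOfFinOrder.2 fun h => by
      obtain ⟨n, hn, h1⟩ := isOfFinOrder_iff_pow_eq_one.1 h
      exact ht n hn h1
  have key : ∀ s s' : G ⧸ ratDerivedOmega G, ∃ i, ∀ j, i ≤ j → ∀ n : ℤ,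
      omegaProj G j (t ^ n * s) = omegaProj G j s' → t ^ n * s = s' := by
    intro s s'
    by_cases h : ∃ n : ℤ, omegaProj G 1 (t ^ n * s) = omegaProj G 1 s'
    · obtain ⟨n, hn⟩ := h
      obtain ⟨i, hi⟩ := exists_forall_omegaProj_eq_imp (t ^ n * s) s'
      refine ⟨max 1 i, fun j hj m hm => ?_⟩
      have h1 : omegaProj G 1 (t ^ m * s) = omegaProj G 1 s' := by
        have hj1 := (le_max_left 1 i).trans hj
        rw [← ratDerivedProj_omegaProj hj1, hm, ratDerivedProj_omegaProj hj1]
      rw [← hn, map_mul, map_mul, map_zpow, map_zpow, mul_left_inj] at h1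
      obtain rfl := hz h1
      exact hi j ((le_max_right 1 i).trans hj) hm
    · push Not at h
      refine ⟨1, fun j hj m hm => absurd ?_ (h m)⟩
      rw [← ratDerivedProj_omegaProj hj, hm, ratDerivedProj_omegaProj hj]
  choose J hJ using key
  refine ⟨(T ×ˢ T).sup fun x => J x.1 x.2, ?_⟩
  rintro j hj _ ⟨n, s, hs, rfl⟩ _ ⟨n', s', hs', rfl⟩ hxy
  have hle : J s s' ≤ j := le_trans (Finset.le_sup (f := fun x :
    (G ⧸ ratDerivedOmega G) × (G ⧸ ratDerivedOmega G) => J x.1 x.2)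
    (Finset.mk_mem_product hs hs')) hj
  have h1 := hJ s s' j hle (n - n') (by
    rw [map_mul, map_mul, map_zpow, map_zpow] at hxy
    rw [map_mul, map_zpow, sub_eq_neg_add, zpow_add, mul_assoc, hxy, zpow_neg,
      inv_mul_cancel_left])
  rw [← h1, ← mul_assoc, ← zpow_add, add_sub_cancel]

section OneRelator

variable {S G : Type*} [Group G] (p : FreeGroup S →* G)

open Polynomial in
theorem exists_monic_smul_fox_eq (hp : Function.Surjective p) {w : FreeGroup S}
    (hw : p.ker = Subgroup.normalClosure {w}) (hfg : (ratDerivedOmega G).FG) (τ : FreeGroup S) :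
    ∃ P : ℤ[X], P.Monic ∧ ∀ u, p u ∈ ratDerivedOmega G →
      ∃ a : MonoidAlgebra ℤ (G ⧸ ratDerivedOmega G),
      P.eval₂ (Int.castRingHom (MonoidAlgebra ℤ (G ⧸ ratDerivedOmega G)))
        (MonoidAlgebra.of ℤ (G ⧸ ratDerivedOmega G) (toQuot p (ratDerivedOmega G) τ)) •
          fox (toQuot p (ratDerivedOmega G)) u = a • fox (toQuot p (ratDerivedOmega G)) w := by
  classical
  set π := toQuot p (ratDerivedOmega G) with hπ
  set Z : Submodule (MonoidAlgebra ℤ (G ⧸ ratDerivedOmega G))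
    (S →₀ MonoidAlgebra ℤ (G ⧸ ratDerivedOmega G)) := Submodule.span _ {fox π w} with hZ
  obtain ⟨T, hT⟩ := hfg
  choose σ hσ using hp
  let d : FreeGroup S → (S →₀ MonoidAlgebra ℤ (G ⧸ ratDerivedOmega G)) ⧸ Z :=
    fun u => Z.mkQ (fox π u)
  let W : Submodule ℤ ((S →₀ MonoidAlgebra ℤ (G ⧸ ratDerivedOmega G)) ⧸ Z) :=
    Submodule.span ℤ ((T.image fun g => d (σ g) : Finset _) : Set _)
  have hTω : ∀ g ∈ T, g ∈ ratDerivedOmega G := fun g hg => hT ▸ Subgroup.subset_closure hg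
  have hd : ∀ u v, p u = p v → p u ∈ ratDerivedOmega G → d u = d v := by
    intro u v huv hu
    have hr : u * v⁻¹ ∈ Subgroup.normalClosure {w} := by
      rw [← hw, MonoidHom.mem_ker, map_mul, map_inv, huv, mul_inv_cancel]
    obtain ⟨h1, a, ha⟩ := fox_mem_of_mem_normalClosure π (toQuot_relator_eq_one p hw _) hr
    have h2 : fox π u = fox π (u * v⁻¹) + fox π v := by
      rw [← fox_mul_of_map_eq_one π h1, inv_mul_cancel_right]
    have h3 : fox π (u * v⁻¹) ∈ Z := Submodule.mem_span_singleton.2 ⟨a, ha.symm⟩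
    refine (Submodule.Quotient.eq Z).2 ?_
    rwa [h2, add_sub_cancel_right]
  have hmul : ∀ u v, p u ∈ ratDerivedOmega G → d (u * v) = d u + d v := by
    intro u v hu
    simp only [d, fox_mul_of_map_eq_one π ((toQuot_eq_one p).2 hu), map_add]
  have hinv : ∀ u, p u ∈ ratDerivedOmega G → d u⁻¹ = -d u := by
    intro u hu
    simp only [d, fox_inv_of_map_eq_one π ((toQuot_eq_one p).2 hu), map_neg]
  have hWmem : ∀ g ∈ ratDerivedOmega G, d (σ g) ∈ W := by
    intro g hg
    have hg' := hg
    rw [← hT] at hg'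
    induction hg' using Subgroup.closure_induction with
    | mem x hx => exact Submodule.subset_span (Finset.mem_coe.2 (Finset.mem_image_of_mem _ hx))
    | one =>
      rw [hd (σ 1) 1 (by rw [hσ, map_one]) (by rw [hσ]; exact one_mem _)]
      simp [d]
    | mul x y hx hy ihx ihy =>
      rw [hT] at hx hy
      rw [hd (σ (x * y)) (σ x * σ y) (by rw [map_mul, hσ, hσ, hσ]) (by rwa [hσ]),
        hmul _ _ (by rwa [hσ])]
      exact add_mem (ihx hx) (ihy hy)
    | inv x hx ihx =>
      rw [hT] at hx
      rw [hd (σ x⁻¹) (σ x)⁻¹ (by rw [map_inv, hσ, hσ]) (by rwa [hσ]), hinv _ (by rwa [hσ])]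
      exact neg_mem (ihx hx)
  have hWmem' : ∀ u, p u ∈ ratDerivedOmega G → d u ∈ W := fun u hu => by
    rw [hd u (σ (p u)) (hσ _).symm hu]
    exact hWmem _ hu
  obtain ⟨P, hP, h⟩ := exists_monic_eval₂_smul_eq_zero
    (MonoidAlgebra.of ℤ (G ⧸ ratDerivedOmega G) (π τ))
    (W := W) ⟨_, rfl⟩ (by
      intro x hx
      induction hx using Submodule.span_induction with
      | mem x hx =>
        obtain ⟨g, hg, rfl⟩ := Finset.mem_image.1 (Finset.mem_coe.1 hx)
        have hgω : p (σ g) ∈ ratDerivedOmega G := by rw [hσ]; exact hTω g hg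
        have : MonoidAlgebra.of ℤ (G ⧸ ratDerivedOmega G) (π τ) • d (σ g) = d (τ * σ g * τ⁻¹) := by
          simp only [d, fox_conj π ((toQuot_eq_one p).2 hgω), map_smul]
        rw [this]
        refine hWmem' _ ?_
        rw [map_mul, map_mul, map_inv]
        exact (ratDerivedOmega_normal G).conj_mem _ hgω _
      | zero => rw [smul_zero]; exact zero_mem _
      | add x y _ _ hx hy => rw [smul_add]; exact add_mem hx hy
      | smul n x _ hx => rw [smul_comm]; exact Submodule.smul_mem _ n hx)
  refine ⟨P, hP, fun u hu => ?_⟩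
  have h1 := h _ (hWmem' u hu)
  simp only [d, ← map_smul] at h1
  rw [Submodule.mkQ_apply, Submodule.Quotient.mk_eq_zero, hZ, Submodule.mem_span_singleton] at h1
  obtain ⟨a, ha⟩ := h1
  exact ⟨a, ha.symm⟩

theorem eq_zero_of_smul_eq_zero {A : Type*} [Ring A] [NoZeroDivisors A] {a : A} (ha : a ≠ 0)
    {m : S →₀ A} (h : a • m = 0) : m = 0 := by
  ext s
  exact (mul_eq_zero.1 (DFunLike.congr_fun h s)).resolve_left ha

theorem exists_pow_mem_commutator_omega_of_ratDerived_one_ne_top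
    (hp : Function.Surjective p) {w : FreeGroup S} (hw : p.ker = Subgroup.normalClosure {w})
    (hne : ratDerivedOmega G ≠ ⊥) (hfg : (ratDerivedOmega G).FG) (h1 : ratDerived G 1 ≠ ⊤)
    {v : G} (hv : v ∈ ratDerivedOmega G) :
    ∃ c : ℕ, 1 ≤ c ∧ v ^ c ∈ ⁅ratDerivedOmega G, ratDerivedOmega G⁆ := by
  obtain ⟨τ', hτ'⟩ : ∃ τ', τ' ∉ ratDerived G 1 := by
    by_contra! h
    exact h1 (eq_top_iff.2 fun x _ => h x)
  obtain ⟨τ, rfl⟩ := hp τ'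
  obtain ⟨u, rfl⟩ := hp v
  set π := toQuot p (ratDerivedOmega G) with hπ
  obtain ⟨P, hP, hPu⟩ := exists_monic_smul_fox_eq p hp hw hfg τ
  obtain ⟨μ, hμ⟩ := hPu u hv
  have ht1 : ∀ n : ℕ, 1 ≤ n → omegaProj G 1 (π τ) ^ n ≠ 1 := by
    intro n hn h
    have h2 : toQuot p (ratDerived G 1) (τ ^ n) = 1 := by
      rw [map_pow, ← h]
      rfl
    rw [toQuot_eq_one, map_pow] at h2
    exact hτ' (mem_ratDerived_of_pow_mem hn h2)
  have ht : ∀ n : ℕ, 1 ≤ n → π τ ^ n ≠ 1 := fun n hn h =>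
    ht1 n hn (by rw [← map_pow, h, map_one])
  obtain ⟨i₁, hi₁⟩ := exists_forall_fox_relator_ne_zero p hp hw hne
  obtain ⟨i₂, hi₂⟩ := exists_injOn_orbit ht1 μ.coeff.support
  set j := max i₁ i₂
  have hDw := hi₁ j (le_max_left _ _)
  obtain ⟨σ, hσt, hσ⟩ := exists_addMonoidHom_section (omegaProj G j) (π τ) (by
    intro y
    constructor
    · rintro ⟨n, s, hs, h⟩
      exact ⟨n - 1, s, hs, by
        rw [sub_eq_neg_add, zpow_add, mul_assoc, h, zpow_neg_one, inv_mul_cancel_left]⟩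
    · rintro ⟨n, s, hs, h⟩
      exact ⟨1 + n, s, hs, by rw [zpow_add, mul_assoc, h, zpow_one]⟩)
    (hi₂ j (le_max_right _ _))
  have hσμ := hσ μ fun s hs => ⟨0, s, hs, by simp⟩
  obtain ⟨c, hc, l, hl⟩ := exists_nsmul_fox_eq_smul p hp hw
    (Subgroup.mem_iInf.1 hv (j + 1))
  obtain ⟨s, hs⟩ := Finsupp.ne_iff.1 hDw
  have hμs : P.eval₂ (Int.castRingHom (MonoidAlgebra ℤ (G ⧸ ratDerived G j)))
      (MonoidAlgebra.of ℤ _ (omegaProj G j (π τ))) *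
      fox (toQuot p (ratDerived G j)) u s =
        MonoidAlgebra.mapDomainRingHom ℤ (omegaProj G j) μ *
          fox (toQuot p (ratDerived G j)) w s := by
    have h2 := congrArg (MonoidAlgebra.mapDomainRingHom ℤ (omegaProj G j))
      (DFunLike.congr_fun hμ s)
    rw [Finsupp.smul_apply, Finsupp.smul_apply, smul_eq_mul, smul_eq_mul, map_mul, map_mul,
      map_eval₂_intCast, ← fox_comp_apply, ← fox_comp_apply, omegaProj_comp_toQuot] at h2
    simpa using h2
  have hls : c • fox (toQuot p (ratDerived G j)) u s =
      l * fox (toQuot p (ratDerived G j)) w s := DFunLike.congr_fun hl s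
  have hPl : P.eval₂ (Int.castRingHom (MonoidAlgebra ℤ (G ⧸ ratDerived G j)))
      (MonoidAlgebra.of ℤ _ (omegaProj G j (π τ))) * l =
      c • MonoidAlgebra.mapDomainRingHom ℤ (omegaProj G j) μ := by
    refine sub_eq_zero.1 ((mul_eq_zero.1 ?_).resolve_right hs)
    rw [sub_mul, mul_assoc, ← hls, mul_smul_comm, hμs, smul_mul_assoc, sub_self]
  have hσl := congrArg σ hPl
  rw [map_eval₂_mul σ hσt, map_nsmul, hσμ] at hσl
  have hD : c • fox π u - σ l • fox π w = 0 := by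
    refine eq_zero_of_smul_eq_zero (eval₂_of_ne_zero ht hP) ?_
    rw [smul_sub, smul_comm, hμ, ← mul_smul, hσl, smul_assoc, sub_self]
  have hπw := toQuot_relator_eq_one p hw (ratDerivedOmega G)
  have hπu : π u = 1 := (toQuot_eq_one p).2 hv
  obtain ⟨r, hr, hrD⟩ := exists_mem_normalClosure_fox_eq π (toQuot_surjective p hp _) hπw (σ l)
  have hπr := (fox_mem_of_mem_normalClosure π hπw hr).1
  have hmem : u ^ c * r⁻¹ ∈ ⁅π.ker, π.ker⁆ := by
    refine mem_commutator_ker_of_fox_eq_zero π (toQuot_surjective p hp _) ?_ ?_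
    · rw [map_mul, map_pow, map_inv, hπu, hπr, one_pow, inv_one, one_mul]
    · rw [fox_mul_of_map_eq_one π (by rw [map_pow, hπu, one_pow]), fox_pow_of_map_eq_one π hπu,
        fox_inv_of_map_eq_one π hπr, hrD, ← sub_eq_add_neg, hD]
  refine ⟨c, hc, ?_⟩
  have h3 := Subgroup.mem_map_of_mem p hmem
  rw [Subgroup.map_commutator, hπ, ker_toQuot, Subgroup.map_comap_eq_self_of_surjective hp] at h3
  rw [← hw, MonoidHom.mem_ker] at hr
  rwa [map_mul, map_inv, hr, inv_one, mul_one, map_pow] at h3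

theorem exists_pow_mem_commutator_omega (hp : Function.Surjective p) {w : FreeGroup S}
    (hw : p.ker = Subgroup.normalClosure {w}) (hne : ratDerivedOmega G ≠ ⊥)
    (hfg : (ratDerivedOmega G).FG) {v : G} (hv : v ∈ ratDerivedOmega G) :
    ∃ c : ℕ, 1 ≤ c ∧ v ^ c ∈ ⁅ratDerivedOmega G, ratDerivedOmega G⁆ := by
  by_cases h1 : ratDerived G 1 = ⊤
  · have htop : ∀ n, ratDerived G n = ⊤ := by
      intro n
      induction n with
      | zero => rfl
      | succ n ih =>
        refine eq_top_iff.2 fun x _ => mem_ratDerived_succ.2 ?_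
        rw [ih]
        exact mem_ratDerived_succ.1 (h1 ▸ Subgroup.mem_top x : x ∈ ratDerived G (0 + 1))
    have hω : ratDerivedOmega G = ⊤ := by simp [ratDerivedOmega, htop]
    rw [hω]
    exact (mem_ratDerived_succ.1 (Subgroup.mem_iInf.1 hv (0 + 1))).2
  · exact exists_pow_mem_commutator_omega_of_ratDerived_one_ne_top p hp hw hne hfg h1 hv

end OneRelator

end FoxCalculus

end

theorem FreeGroup.ratSum_eq_zero_of_mem_commutator {E : Type*} (φ : E → ℚ) {x : FreeGroup E}
    (hx : x ∈ commutator (FreeGroup E)) : ratSum φ x = 0 := by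
  rw [commutator_eq_closure] at hx
  induction hx using Subgroup.closure_induction with
  | mem x hx =>
    obtain ⟨a, b, rfl⟩ := hx
    simp only [commutatorElement_def, ratSum_mul, ratSum_inv]
    ring
  | one => simp
  | mul x y _ _ hx hy => rw [ratSum_mul, hx, hy, add_zero]
  | inv x _ hx => rw [ratSum_inv, hx, neg_zero]

/-- If a torsion-free one-relator group `G = F/⟪w⟫` is not residually
ℚ-solvable, then its maximal rationally perfect subgroup `D^ω(G)` is not finitely
generated. -/
theorem ratDerivedOmega_not_fg {S : Type*} (w : FreeGroup S)
    (htf : ∀ g : FreeGroup S ⧸ Subgroup.normalClosure {w}, IsOfFinOrder g → g = 1)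
    (h : ¬ ResiduallyQSolvable (FreeGroup S ⧸ Subgroup.normalClosure {w})) :
    ¬ (ratDerivedOmega (FreeGroup S ⧸ Subgroup.normalClosure {w})).FG := by
  intro hfg
  set p := QuotientGroup.mk' (Subgroup.normalClosure {w})
  have hps : Function.Surjective p := QuotientGroup.mk'_surjective _
  have hw : p.ker = Subgroup.normalClosure {w} := QuotientGroup.ker_mk' _
  set N := ratDerivedOmega (FreeGroup S ⧸ Subgroup.normalClosure {w}) with hN
  obtain ⟨T, hT⟩ := id hfg
  choose σ hσ using hps
  let k : T → FreeGroup S := fun g => σ g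
  have hpk : ∀ g : T, p (k g) = g := fun g => hσ g
  set f := p.comp (FreeGroup.lift k) with hf
  have hrange : N = Subgroup.map f ⊤ := by
    rw [← MonoidHom.range_eq_map, ← hT, hf, MonoidHom.range_comp, FreeGroup.range_lift_eq_closure,
      MonoidHom.map_closure, ← Set.range_comp]
    congr 1
    ext x
    simp [hpk]
  have key : ∀ g : T, ∃ n : ℕ, 1 ≤ n ∧ ∃ y ∈ commutator (FreeGroup T), f y = p (k g ^ n) := by
    intro g
    obtain ⟨n, hn, hg⟩ := FoxCalculus.exists_pow_mem_commutator_omega p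
      (QuotientGroup.mk'_surjective _) hw h hfg
      (show p (k g) ∈ N by rw [hpk, ← hT]; exact Subgroup.subset_closure g.2)
    rw [← hN, hrange, ← Subgroup.map_commutator] at hg
    obtain ⟨y, hy, hyg⟩ := hg
    exact ⟨n, hn, y, hy, by rw [hyg, map_pow]⟩
  choose n hn y hy hyn using key
  refine h ?_
  change N = ⊥
  rw [← hT, Subgroup.closure_eq_bot_iff]
  intro g hg
  rw [Set.mem_singleton_iff, ← hσ g, ← MonoidHom.mem_ker, hw]
  refine FreeGroup.mem_normalClosure_of_rational
    (fun c m hc => FoxCalculus.eq_one_of_eq_pow p (QuotientGroup.mk'_surjective _) hw h htf c m hc)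
    (c := fun g : T => FreeGroup.of g ^ (n g : ℤ) * (y g)⁻¹) (u := k) (fun φ hφ g => ?_)
    (fun g => ?_) ⟨g, hg⟩
  · have := hφ g
    rw [FreeGroup.ratSum_mul, FreeGroup.ratSum_inv,
      FreeGroup.ratSum_eq_zero_of_mem_commutator φ (hy g), FreeGroup.ratSum_zpow,
      FreeGroup.ratSum_of, neg_zero, add_zero] at this
    have hne : ((n g : ℤ) : ℚ) ≠ 0 := by exact_mod_cast (Nat.one_le_iff_ne_zero.1 (hn g))
    exact (mul_eq_zero.1 this).resolve_left hne
  · refine hw.le (MonoidHom.mem_ker.2 ?_)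
    rw [map_mul, map_mul, map_inv, map_inv, mul_inv_eq_one]
    refine Eq.trans ?_ (hyn g).symm
    rw [map_zpow, FreeGroup.lift_apply_of, zpow_natCast]
end

section
/- Let G be a group and N a normal subgroup of G. If N is residually ℚ-solvable and the quotient G/N is ℚ-solvable, then G is residually ℚ-solvable. -/
theorem map_ratDerived_le {G H : Type*} [Group G] [Group H] (f : G →* H) (i : ℕ) :
    (ratDerived G i).map f ≤ ratDerived H i := by
  induction i with
  | zero => exact le_top
  | succ i ih =>
    rw [Subgroup.map_le_iff_le_comap]
    refine (Subgroup.closure_le _).2 ?_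
    rintro g ⟨hg, k, hk, hgk⟩
    refine Subgroup.subset_closure ⟨ih ⟨g, hg, rfl⟩, k, hk, ?_⟩
    rw [← map_pow]
    apply Subgroup.commutator_mono ih ih
    rw [← Subgroup.map_commutator]
    exact ⟨_, hgk, rfl⟩

theorem ratDerived_add_le_map_subtype {G : Type*} [Group G] {N : Subgroup G} {n : ℕ}
    (hn : ratDerived G n ≤ N) (i : ℕ) :
    ratDerived G (n + i) ≤ (ratDerived N i).map N.subtype := by
  induction i with
  | zero => exact fun x hx => ⟨⟨x, hn hx⟩, Subgroup.mem_top _, rfl⟩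
  | succ i ih =>
    refine (Subgroup.closure_le _).2 ?_
    rintro g ⟨hg, k, hk, hgk⟩
    obtain ⟨x, hx, rfl⟩ := ih hg
    have hxk := Subgroup.commutator_mono ih ih hgk
    rw [← Subgroup.map_commutator, ← map_pow] at hxk
    exact ⟨x, Subgroup.subset_closure ⟨hx, k, hk,
      (Subgroup.mem_map_iff_mem N.subtype_injective).1 hxk⟩, rfl⟩

/-- A (residually ℚ-solvable)-by-(ℚ-solvable) group is residually
ℚ-solvable. -/
theorem residuallyQSolvable_of_normal {G : Type*} [Group G] (N : Subgroup G) [N.Normal]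
    (h1 : ResiduallyQSolvable ↥N) (h2 : QSolvable (G ⧸ N)) :
    ResiduallyQSolvable G := by
  obtain ⟨n, hn⟩ := h2
  have hN : ratDerived G n ≤ N := by
    intro x hx
    have hx' := map_ratDerived_le (QuotientGroup.mk' N) n ⟨x, hx, rfl⟩
    rw [hn, Subgroup.mem_bot] at hx'
    exact (QuotientGroup.eq_one_iff x).1 hx'
  refine (Subgroup.eq_bot_iff_forall _).2 fun x hx => ?_
  have hx' : ∀ i, x ∈ ratDerived G i := Subgroup.mem_iInf.1 hx
  have hy : (⟨x, hN (hx' n)⟩ : N) ∈ ratDerivedOmega N := by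
    refine Subgroup.mem_iInf.2 fun i => ?_
    obtain ⟨y, hy, rfl⟩ := ratDerived_add_le_map_subtype hN i (hx' (n + i))
    exact hy
  rw [show ratDerivedOmega N = ⊥ from h1, Subgroup.mem_bot] at hy
  exact congrArg Subtype.val hy
end
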